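/- arXiv:1601.06991 — 2 statements merged into one kernel-verified Lean document; each statement's English description precedes it below -/
import Mathlib

section
/- There exist absolute constants c, C > 0 such that the following holds. For every integer n ≥ 1, every real q with 0 < q < 1, and every s ∈ {1,…,n}, if π is a random permutation with the Mallows distribution μ_{n,q}, then: (i) c · min{q/(1−q)^2, n−1} ≤ E[max(C_s(π)) − min(C_s(π))] ≤ C · min{q/(1−q)^2, n−1}; (ii) c · min{q/(1−q)^2, n−s} ≤ E[max(C_s(π)) − s] ≤ C · min{q/(1−q)^2, n−s}; and (iii) c · min{q/(1−q)^2, s−1} ≤ E[s − min(C_s(π))] ≤ C · min{q/(1−q)^2, s−1}. -/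
open Finset
open scoped Classical BigOperators

noncomputable section

/-- Number of inversions of a permutation of `Fin n` (0-indexed positions). -/
def invCount (n : ℕ) (π : Equiv.Perm (Fin n)) : ℕ :=
  ((Finset.univ : Finset (Fin n × Fin n)).filter
    (fun p => p.1 < p.2 ∧ π p.2 < π p.1)).card

/-- Normalizing constant of the Mallows distribution. -/
def mallowsZ (n : ℕ) (q : ℝ) : ℝ :=
  ∑ σ : Equiv.Perm (Fin n), q ^ invCount n σ

/-- Mallows probability of an individual permutation. -/
def mallowsP (n : ℕ) (q : ℝ) (π : Equiv.Perm (Fin n)) : ℝ :=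
  q ^ invCount n π / mallowsZ n q

/-- Expectation of a real-valued functional under the Mallows distribution. -/
def mExp (n : ℕ) (q : ℝ) (X : Equiv.Perm (Fin n) → ℝ) : ℝ :=
  ∑ π : Equiv.Perm (Fin n), mallowsP n q π * X π

/-- Probability of an event under the Mallows distribution. -/
def mProb (n : ℕ) (q : ℝ) (A : Equiv.Perm (Fin n) → Prop) : ℝ :=
  ∑ π : Equiv.Perm (Fin n), if A π then mallowsP n q π else 0

/-- Conditional probability of `A` given `B` under the Mallows distribution. -/
def mCondProb (n : ℕ) (q : ℝ) (A B : Equiv.Perm (Fin n) → Prop) : ℝ :=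
  mProb n q (fun π => A π ∧ B π) / mProb n q B

/-- The set of points of the cycle of `π` containing `s`. -/
def cycleSet (n : ℕ) (π : Equiv.Perm (Fin n)) (s : Fin n) : Finset (Fin n) :=
  Finset.univ.filter (fun t => π.SameCycle s t)

lemma self_mem_cycleSet (n : ℕ) (π : Equiv.Perm (Fin n)) (s : Fin n) :
    s ∈ cycleSet n π s :=
  Finset.mem_filter.mpr ⟨Finset.mem_univ _, Equiv.Perm.SameCycle.refl _ _⟩

/-- Maximal element of the cycle of `s`, in 1-indexed labelling `{1,…,n}`. -/
def cycMax (n : ℕ) (π : Equiv.Perm (Fin n)) (s : Fin n) : ℕ :=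
  (cycleSet n π s).sup (fun t => (t : ℕ) + 1)

/-- Minimal element of the cycle of `s`, in 1-indexed labelling `{1,…,n}`. -/
def cycMin (n : ℕ) (π : Equiv.Perm (Fin n)) (s : Fin n) : ℕ :=
  (cycleSet n π s).inf' ⟨s, self_mem_cycleSet n π s⟩ (fun t => (t : ℕ) + 1)

/-- Inversions change by one when exchanging consecutive remaining values. -/
lemma inv_swap (n : ℕ) (π : Equiv.Perm (Fin n)) (v v' : Fin n) (hv : v < v')
    (hp : π⁻¹ v < π⁻¹ v') (hb : ∀ x, v < x → x < v' → π⁻¹ x < π⁻¹ v) :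
    invCount n (Equiv.swap v v' * π) = invCount n π + 1 := by
  obtain ⟨p, hpv⟩ : ∃ p, π p = v := ⟨π⁻¹ v, by simp⟩
  obtain ⟨p', hpv'⟩ : ∃ p, π p = v' := ⟨π⁻¹ v', by simp⟩
  have e1 : π⁻¹ v = p := by rw [← hpv]; simp
  have e2 : π⁻¹ v' = p' := by rw [← hpv']; simp
  rw [e1, e2] at hp
  have hb' : ∀ i, v < π i → π i < v' → i < p := by
    intro i h1 h2
    have := hb (π i) h1 h2
    rw [e1] at this
    simpa using this
  have hs : ∀ i, (Equiv.swap v v' * π) i = if i = p then v' else if i = p' then v else π i := by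
    intro i
    rw [Equiv.Perm.mul_apply]
    by_cases h1 : i = p
    · subst h1; simp [hpv]
    · by_cases h2 : i = p'
      · subst h2; simp [hpv', h1]
      · simp only [h1, h2, if_false]
        apply Equiv.swap_apply_of_ne_of_ne
        · rw [← hpv]; intro h; exact h1 (π.injective h)
        · rw [← hpv']; intro h; exact h2 (π.injective h)
  unfold invCount
  have hnot : (p, p') ∉ (Finset.univ : Finset (Fin n × Fin n)).filter
      (fun x => x.1 < x.2 ∧ π x.2 < π x.1) := by
    simp [hpv, hpv', hv.le]
  have hinj := π.injective
  have hne : ∀ i, π i = v → i = p := fun i h => hinj (h.trans hpv.symm)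
  have hne' : ∀ i, π i = v' → i = p' := fun i h => hinj (h.trans hpv'.symm)
  have hmem : (p, p') ∈ (Finset.univ : Finset (Fin n × Fin n)).filter
      (fun x => x.1 < x.2 ∧ (Equiv.swap v v' * π) x.2 < (Equiv.swap v v' * π) x.1) := by
    simp only [mem_filter, mem_univ, true_and, hs]
    refine ⟨hp, ?_⟩
    simp [hp.ne', hv]
  rw [← Finset.card_erase_add_one hmem]
  congr 1
  symm
  let φ : Fin n × Fin n → Fin n × Fin n := fun x => if x.1 < p then (x.1, Equiv.swap p p' x.2) else x
  have hφ : ∀ a b, φ (a, b) = if a < p then (a, if b = p then p' else if b = p' then p else b)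
      else (a, b) := by
    intro a b
    simp only [φ, Equiv.swap_apply_def]
  have hσp : (Equiv.swap v v' * π) p = v' := by rw [hs]; simp
  have hσp' : (Equiv.swap v v' * π) p' = v := by rw [hs]; simp [hp.ne']
  have hσ : ∀ i, i ≠ p → i ≠ p' → (Equiv.swap v v' * π) i = π i := by
    intro i h1 h2; rw [hs]; simp [h1, h2]
  have hgap : ∀ i, p ≤ i → i ≠ p → i ≠ p' → (π i < v ↔ π i < v') := by
    intro i h1 h2 h3
    constructor
    · intro h; exact h.trans hv
    · intro h
      by_contra hc
      rcases lt_or_eq_of_le (not_lt.mp hc) with h4 | h4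
      · exact absurd (hb' i h4 h) (not_lt.mpr h1)
      · exact h2 (hne i h4.symm)
  have hgap2 : ∀ i, p ≤ i → i ≠ p → i ≠ p' → (v < π i ↔ v' < π i) := by
    intro i h1 h2 h3
    have := hgap i h1 h2 h3
    have h4 : π i ≠ v := fun h => h2 (hne i h)
    have h5 : π i ≠ v' := fun h => h3 (hne' i h)
    constructor
    · intro h
      by_contra hc
      exact lt_asymm h (this.mpr (lt_of_le_of_ne (not_lt.mp hc) h5))
    · intro h; exact hv.trans h
  have hφp : ∀ a, a < p → φ (a, p) = (a, p') := by intro a h; rw [hφ]; simp [h]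
  have hφp' : ∀ a, a < p → φ (a, p') = (a, p) := by intro a h; rw [hφ]; simp [h, hp.ne']
  have hφo : ∀ a b, b ≠ p → b ≠ p' → φ (a, b) = (a, b) := by
    intro a b h1 h2; rw [hφ]; simp [h1, h2]
  have hφn : ∀ a b, ¬ a < p → φ (a, b) = (a, b) := by intro a b h; rw [hφ]; simp [h]
  generalize (Equiv.swap v v' * π) = σ at hσp hσp' hσ
  have key : ∀ x : Fin n × Fin n,
      ((x.1 < x.2 ∧ π x.2 < π x.1) ↔ (φ x ≠ (p, p') ∧ (φ x).1 < (φ x).2 ∧ σ (φ x).2 < σ (φ x).1)) := by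
    rintro ⟨a, b⟩
    by_cases ha : a < p
    · have ha1 : a ≠ p := ha.ne
      have ha2 : a ≠ p' := (ha.trans hp).ne
      have hx : ∀ c, (a, c) ≠ (p, p') := by intro c h; exact ha1 (congrArg Prod.fst h)
      have ha3 := ha.trans hp
      by_cases h1 : b = p
      · subst h1
        rw [hφp a ha]
        simp [hx, ha, ha3, hσp', hσ a ha1 ha2, hpv]
      · by_cases h2 : b = p'
        · subst h2
          rw [hφp' a ha]
          simp [hx, ha, ha3, hσp, hσ a ha1 ha2, hpv']
        · rw [hφo a b h1 h2]
          simp [hx, hσ a ha1 ha2, hσ b h1 h2]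
    · rw [hφn a b ha]
      by_cases hab : a < b
      · have hpb : p < b := lt_of_le_of_lt (not_lt.mp ha) hab
        have h1 : b ≠ p := hpb.ne'
        by_cases h2 : b = p'
        · subst h2
          by_cases h3 : a = p
          · subst h3
            simp [hpv, hpv', hv.le]
          · have := hgap2 a (not_lt.mp ha) h3 hab.ne
            simp [h3, hab, hpv', hσp', hσ a h3 hab.ne, this]
        · have g := hgap b hpb.le h1 h2
          by_cases h3 : a = p
          · subst h3
            simp [h2, hab, hpv, hσp, hσ b h1 h2, g]
          · by_cases h4 : a = p'
            · subst h4
              simp [h3, hab, hpv', hσp', hσ b h1 h2, g]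
            · simp [h3, hab, hσ b h1 h2, hσ a h3 h4]
      · simp [hab]
  have hinv : ∀ x, φ (φ x) = x := by
    rintro ⟨a, b⟩
    by_cases ha : a < p
    · by_cases h1 : b = p
      · subst h1; rw [hφp a ha, hφp' a ha]
      · by_cases h2 : b = p'
        · subst h2; rw [hφp' a ha, hφp a ha]
        · rw [hφo a b h1 h2, hφo a b h1 h2]
    · rw [hφn a b ha, hφn a b ha]
  refine Finset.card_nbij' φ φ ?_ ?_ (fun x _ => hinv x) (fun x _ => hinv x)
  · intro x h
    have h' := (mem_filter.mp (mem_coe.mp h)).2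
    have h2 := (key x).mp h'
    exact mem_coe.mpr (mem_erase.mpr ⟨h2.1, mem_filter.mpr ⟨mem_univ _, h2.2⟩⟩)
  · intro x h
    have h' := mem_erase.mp (mem_coe.mp h)
    have h2 := (key (φ x)).mpr (by rw [hinv]; exact ⟨h'.1, (mem_filter.mp h'.2).2⟩)
    exact mem_coe.mpr (mem_filter.mpr ⟨mem_univ _, h2⟩)

/-- Geometric sum. -/
def gs (q : ℝ) (m : ℕ) : ℝ := ∑ i ∈ Finset.range m, q ^ i

lemma geo_rank {n : ℕ} (q : ℝ) (S : Finset (Fin n)) :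
    ∑ v ∈ S, q ^ (S.filter (fun x => x < v)).card = gs q S.card := by
  induction S using Finset.induction_on_max with
  | empty => simp [gs]
  | insert a S ha ih =>
    have hna : a ∉ S := fun h => lt_irrefl _ (ha a h)
    rw [Finset.sum_insert hna, Finset.card_insert_of_notMem hna, gs, Finset.sum_range_succ,
      ← gs, ← ih, add_comm]
    congr 1
    · apply Finset.sum_congr rfl
      intro v hv
      congr 2
      rw [Finset.filter_insert, if_neg (not_lt.mpr (ha v hv).le)]
    · congr 2
      rw [Finset.filter_insert, if_neg (lt_irrefl _), Finset.filter_true_of_mem ha]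

lemma geo_exists {n : ℕ} (q : ℝ) (W : Fin n → ℝ) (S : Finset (Fin n))
    (h : ∀ v ∈ S, ∀ v' ∈ S, v < v' → (∀ x, v < x → x < v' → x ∉ S) → W v' = q * W v) :
    ∃ W0, ∀ v ∈ S, W v = q ^ (S.filter (fun x => x < v)).card * W0 := by
  induction S using Finset.induction_on_max with
  | empty => simp
  | insert a S ha ih =>
    have hna : a ∉ S := fun h => lt_irrefl _ (ha a h)
    obtain ⟨W0, hW0⟩ := ih (by
      intro v hv v' hv' hlt hx
      apply h v (by simp [hv]) v' (by simp [hv']) hlt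
      intro x h1 h2 h3
      rcases Finset.mem_insert.mp h3 with rfl | h3
      · exact lt_asymm h2 (ha v' hv')
      · exact hx x h1 h2 h3)
    by_cases hS : S.Nonempty
    · refine ⟨W0, ?_⟩
      intro v hv
      rcases Finset.mem_insert.mp hv with rfl | hv
      · have hm := S.max'_mem hS
        have := h (S.max' hS) (by simp [hm]) v (by simp) (ha _ hm) (by
          intro x h1 h2 h3
          rcases Finset.mem_insert.mp h3 with rfl | h3
          · exact lt_irrefl _ h2
          · exact not_lt.mpr (S.le_max' x h3) h1)
        rw [this, hW0 _ hm, Finset.filter_insert, if_neg (lt_irrefl _),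
          Finset.filter_true_of_mem ha]
        have e : S.filter (fun x => x < S.max' hS) = S.erase (S.max' hS) := by
          ext x
          simp only [mem_filter, mem_erase]
          constructor
          · rintro ⟨h1, h2⟩; exact ⟨h2.ne, h1⟩
          · rintro ⟨h1, h2⟩; exact ⟨h2, lt_of_le_of_ne (S.le_max' x h2) h1⟩
        rw [e, ← Finset.card_erase_add_one hm, pow_succ]
        ring
      · rw [hW0 v hv, Finset.filter_insert, if_neg (not_lt.mpr (ha v hv).le)]
    · rw [Finset.not_nonempty_iff_eq_empty] at hS
      subst hS
      refine ⟨W a, ?_⟩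
      intro v hv
      simp at hv
      subst hv
      simp [Finset.filter_singleton]

lemma geo_main {n : ℕ} (q : ℝ) (W : Fin n → ℝ) (S : Finset (Fin n))
    (h : ∀ v ∈ S, ∀ v' ∈ S, v < v' → (∀ x, v < x → x < v' → x ∉ S) → W v' = q * W v) (u : ℕ) :
    (∑ v ∈ S.filter (fun v => v.val < u), W v) * gs q S.card =
      gs q (S.filter (fun v => v.val < u)).card * ∑ v ∈ S, W v := by
  obtain ⟨W0, hW⟩ := geo_exists q W S h
  have h1 : ∑ v ∈ S, W v = gs q S.card * W0 := by
    rw [← geo_rank, Finset.sum_mul]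
    exact Finset.sum_congr rfl hW
  have h2 : ∑ v ∈ S.filter (fun v => v.val < u), W v =
      gs q (S.filter (fun v => v.val < u)).card * W0 := by
    rw [← geo_rank, Finset.sum_mul]
    apply Finset.sum_congr rfl
    intro v hv
    rw [Finset.mem_filter] at hv
    rw [hW v hv.1]
    congr 3
    ext x
    simp only [mem_filter]
    constructor
    · rintro ⟨a, b⟩
      exact ⟨⟨a, lt_trans b hv.2⟩, b⟩
    · rintro ⟨⟨a, _⟩, b⟩
      exact ⟨a, b⟩
  rw [h1, h2]; ring

lemma fib_le {α : Type*} [Fintype α] (r : α → α → Prop) (hr : Equivalence r) (F F' : α → ℝ)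
    (h : ∀ a0, ∑ a with r a a0, F a ≤ ∑ a with r a a0, F' a) : ∑ a, F a ≤ ∑ a, F' a := by
  let ρ : α → Quotient (⟨r, hr⟩ : Setoid α) := fun a => Quotient.mk _ a
  have e : ∀ G : α → ℝ, ∑ a, G a = ∑ b ∈ univ.image ρ, ∑ a with ρ a = b, G a := by
    intro G
    symm
    exact Finset.sum_fiberwise_of_maps_to (fun a ha => Finset.mem_image_of_mem _ ha) _
  rw [e F, e F']
  apply Finset.sum_le_sum
  intro b hb
  obtain ⟨a0, -, rfl⟩ := Finset.mem_image.mp hb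
  have e2 : ∀ a, ρ a = ρ a0 ↔ r a a0 := by
    intro a
    exact Quotient.eq (r := (⟨r, hr⟩ : Setoid α))
  have := h a0
  simp only [e2]
  exact this

lemma fib_eq {α : Type*} [Fintype α] (r : α → α → Prop) (hr : Equivalence r) (F F' : α → ℝ)
    (h : ∀ a0, ∑ a with r a a0, F a = ∑ a with r a a0, F' a) : ∑ a, F a = ∑ a, F' a :=
  le_antisymm (fib_le r hr F F' fun a => (h a).le) (fib_le r hr F' F fun a => (h a).ge)

def wt (n : ℕ) (q : ℝ) (π : Equiv.Perm (Fin n)) : ℝ := q ^ invCount n π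

lemma invCount_inv (n : ℕ) (π : Equiv.Perm (Fin n)) : invCount n π⁻¹ = invCount n π := by
  unfold invCount
  refine Finset.card_nbij' (fun x => (π⁻¹ x.2, π⁻¹ x.1)) (fun x => (π x.2, π x.1)) ?_ ?_ ?_ ?_
  · rintro ⟨a, b⟩ h
    simp at h ⊢
    tauto
  · rintro ⟨a, b⟩ h
    simp at h ⊢
    tauto
  · rintro ⟨a, b⟩ h
    simp
  · rintro ⟨a, b⟩ h
    simp

lemma wt_inv (n : ℕ) (q : ℝ) (π : Equiv.Perm (Fin n)) : wt n q π⁻¹ = wt n q π := by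
  rw [wt, wt, invCount_inv]

/-- agreement of the first rows -/
def agree1 (n : ℕ) (t : Fin n) (π π0 : Equiv.Perm (Fin n)) : Prop := ∀ i, i < t → π i = π0 i

lemma agree1_equiv (n : ℕ) (t : Fin n) : Equivalence (agree1 n t) where
  refl := fun _ _ _ => rfl
  symm := fun h i hi => (h i hi).symm
  trans := fun h h' i hi => (h i hi).trans (h' i hi)

lemma agree1_inv {n : ℕ} {t : Fin n} {π π0 : Equiv.Perm (Fin n)} (h : agree1 n t π π0) (x : Fin n) :
    t ≤ π⁻¹ x ↔ t ≤ π0⁻¹ x := by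
  have key : ∀ {π π0 : Equiv.Perm (Fin n)}, agree1 n t π π0 → t ≤ π⁻¹ x → t ≤ π0⁻¹ x := by
    intro π π0 h h1
    by_contra h2
    have h3 := h (π0⁻¹ x) (not_le.mp h2)
    have h4 : π⁻¹ x = π0⁻¹ x := by
      rw [Equiv.Perm.inv_eq_iff_eq, h3]; simp
    rw [h4] at h1
    exact h2 h1
  exact ⟨key h, key ((agree1_equiv n t).symm h)⟩

lemma one_sided (n : ℕ) (q : ℝ) (t : Fin n) (π0 : Equiv.Perm (Fin n)) (u : ℕ) :
    (∑ π with agree1 n t π π0 ∧ (π t).val < u, wt n q π) * gs q (n - t.val) =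
      gs q (univ.filter (fun v : Fin n => v.val < u ∧ t ≤ π0⁻¹ v)).card *
        ∑ π with agree1 n t π π0, wt n q π := by
  set S : Finset (Fin n) := univ.filter (fun v => t ≤ π0⁻¹ v) with hS
  set W : Fin n → ℝ := fun v => ∑ π with agree1 n t π π0 ∧ π t = v, wt n q π with hW
  have hmS : ∀ v, v ∈ S ↔ t ≤ π0⁻¹ v := by intro v; simp [hS]
  have hcard : S.card = n - t.val := by
    rw [← Fin.card_Ici]
    refine Finset.card_nbij' π0.symm π0 ?_ ?_ ?_ ?_
    · intro v hv; simpa [hS] using hv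
    · intro v hv; simpa [hS] using hv
    · intro v hv; simp
    · intro v hv; simp
  have hmain := geo_main q W S (by
    intro v hv v' hv' hlt hx
    rw [hmS] at hv hv'
    simp only [hW]
    rw [Finset.mul_sum]
    have sw : ∀ π, agree1 n t π π0 → agree1 n t (Equiv.swap v v' * π) π0 := by
      intro π h i hi
      rw [Equiv.Perm.mul_apply, h i hi]
      apply Equiv.swap_apply_of_ne_of_ne
      · rintro rfl; simp at hv; exact not_lt.mpr hv hi
      · rintro rfl; simp at hv'; exact not_lt.mpr hv' hi
    symm
    refine Finset.sum_nbij' (fun π => Equiv.swap v v' * π) (fun π => Equiv.swap v v' * π)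
      ?_ ?_ ?_ ?_ ?_
    · intro π h
      simp only [mem_filter, mem_univ, true_and] at h ⊢
      exact ⟨sw π h.1, by rw [Equiv.Perm.mul_apply, h.2]; simp⟩
    · intro π h
      simp only [mem_filter, mem_univ, true_and] at h ⊢
      exact ⟨sw π h.1, by rw [Equiv.Perm.mul_apply, h.2]; simp⟩
    · intro π _; rw [← mul_assoc]; simp
    · intro π _; rw [← mul_assoc]; simp
    · intro π h
      simp only [mem_filter, mem_univ, true_and] at h
      have e : π⁻¹ v = t := by rw [Equiv.Perm.inv_eq_iff_eq, h.2]
      rw [wt, wt, inv_swap n π v v' hlt, pow_succ, mul_comm]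
      · rw [e]
        apply lt_of_le_of_ne
        · rwa [agree1_inv h.1]
        · rw [← e]; intro h'; exact hlt.ne (π⁻¹.injective h')
      · intro x h1 h2
        have := hx x h1 h2
        rw [hmS, ← agree1_inv h.1] at this
        rw [e]; exact not_le.mp this) u
  rw [hcard] at hmain
  have f1 : S.filter (fun v => v.val < u) = univ.filter (fun v : Fin n => v.val < u ∧ t ≤ π0⁻¹ v) := by
    ext v; simp [hS, and_comm]
  have hin : ∀ π, agree1 n t π π0 → π t ∈ S := by
    intro π h
    rw [hmS, ← agree1_inv h]; simp
  have f2 : ∑ v ∈ S, W v = ∑ π with agree1 n t π π0, wt n q π := by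
    rw [← Finset.sum_fiberwise_of_maps_to (s := univ.filter (fun π => agree1 n t π π0)) (t := S)
      (g := fun π => π t)]
    · apply Finset.sum_congr rfl
      intro v _
      simp only [hW]
      rw [Finset.filter_filter]
    · intro π h
      exact hin π (mem_filter.mp h).2
  have f3 : ∑ v ∈ S.filter (fun v => v.val < u), W v =
      ∑ π with agree1 n t π π0 ∧ (π t).val < u, wt n q π := by
    rw [← Finset.sum_fiberwise_of_maps_to
      (s := univ.filter (fun π => agree1 n t π π0 ∧ (π t).val < u))
      (t := S.filter (fun v => v.val < u)) (g := fun π => π t)]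
    · apply Finset.sum_congr rfl
      intro v hv
      simp only [hW]
      rw [Finset.filter_filter]
      apply Finset.sum_congr _ (fun _ _ => rfl)
      ext π
      have := (mem_filter.mp hv).2
      simp only [mem_filter, mem_univ, true_and]
      constructor
      · rintro ⟨a, rfl⟩; exact ⟨⟨a, this⟩, rfl⟩
      · rintro ⟨⟨a, _⟩, b⟩; exact ⟨a, b⟩
    · intro π h
      have := (mem_filter.mp h).2
      exact mem_filter.mpr ⟨hin π this.1, this.2⟩
  rw [← f1, ← f2, ← f3]
  exact hmain

/-- one-sided law on any event measurable with respect to the first rows. -/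
lemma one_sided_Q (n : ℕ) (q : ℝ) (t : Fin n) (u c : ℕ) (Q : Equiv.Perm (Fin n) → Prop)
    (hQ : ∀ π π0, agree1 n t π π0 → Q π0 → Q π)
    (hc : ∀ π, Q π → (univ.filter (fun v : Fin n => v.val < u ∧ t ≤ π⁻¹ v)).card = c) :
    (∑ π with Q π ∧ (π t).val < u, wt n q π) * gs q (n - t.val) =
      gs q c * ∑ π with Q π, wt n q π := by
  rw [Finset.sum_filter, Finset.sum_filter, Finset.sum_mul, Finset.mul_sum]
  apply fib_eq (agree1 n t) (agree1_equiv n t)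
  intro π0
  by_cases h0 : Q π0
  · have h := one_sided n q t π0 u
    rw [hc π0 h0, Finset.sum_mul, Finset.mul_sum, ← Finset.filter_filter, Finset.sum_filter] at h
    have hq : ∀ π ∈ univ.filter (fun π => agree1 n t π π0), Q π := by
      intro π hπ
      exact hQ π π0 (mem_filter.mp hπ).2 h0
    calc _ = _ := ?_
      _ = _ := h
      _ = _ := ?_
    · apply Finset.sum_congr rfl
      intro π hπ
      simp [hq π hπ]
    · apply Finset.sum_congr rfl
      intro π hπ
      simp [hq π hπ]
  · have hq : ∀ π ∈ univ.filter (fun π => agree1 n t π π0), ¬ Q π := by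
      intro π hπ h
      exact h0 (hQ π0 π ((agree1_equiv n t).symm (mem_filter.mp hπ).2) h)
    rw [Finset.sum_eq_zero, Finset.sum_eq_zero]
    · intro π hπ; simp [hq π hπ]
    · intro π hπ; simp [hq π hπ]

/-- the same for inverses -/
lemma one_sided_Q_inv (n : ℕ) (q : ℝ) (t : Fin n) (u c : ℕ) (Q : Equiv.Perm (Fin n) → Prop)
    (hQ : ∀ π π0, agree1 n t π⁻¹ π0⁻¹ → Q π0 → Q π)
    (hc : ∀ π, Q π → (univ.filter (fun v : Fin n => v.val < u ∧ t ≤ π v)).card = c) :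
    (∑ π with Q π ∧ (π⁻¹ t).val < u, wt n q π) * gs q (n - t.val) =
      gs q c * ∑ π with Q π, wt n q π := by
  have h := one_sided_Q n q t u c (fun π => Q π⁻¹)
    (fun π π0 h1 h2 => hQ π⁻¹ π0⁻¹ (by simpa using h1) h2) (fun π h => by simpa using hc π⁻¹ h)
  have e : ∀ P : Equiv.Perm (Fin n) → Prop, ∑ π with P π⁻¹, wt n q π = ∑ π with P π, wt n q π := by
    intro P
    refine Finset.sum_nbij' (fun π => π⁻¹) (fun π => π⁻¹) ?_ ?_ ?_ ?_ ?_
    · intro π h; simpa using h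
    · intro π h; simpa using h
    · intro π h; simp
    · intro π h; simp
    · intro π h; exact (wt_inv n q π).symm
  have e1 := e Q
  have e2 := e (fun π => Q π ∧ (π⁻¹ t).val < u)
  rw [e1] at h
  rw [← h]
  congr 1
  simp only [inv_inv] at e2
  convert e2.symm using 2
  ext π; simp

/-- number of open arcs -/
def kap (n t : ℕ) (π : Equiv.Perm (Fin n)) : ℕ :=
  (univ.filter (fun i : Fin n => i.val < t ∧ t ≤ (π i).val)).card

lemma kap_tail (n t : ℕ) (π : Equiv.Perm (Fin n)) :
    (univ.filter (fun v : Fin n => v.val < t ∧ t ≤ (π⁻¹ v).val)).card = kap n t π := by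
  have h1 := Finset.card_filter_add_card_filter_not
    (s := univ.filter (fun v : Fin n => v.val < t)) (fun v => t ≤ (π⁻¹ v).val)
  have h2 := Finset.card_filter_add_card_filter_not
    (s := univ.filter (fun v : Fin n => v.val < t)) (fun v => t ≤ (π v).val)
  rw [Finset.filter_filter, Finset.filter_filter] at h1 h2
  have h3 : (univ.filter (fun v : Fin n => v.val < t ∧ ¬ t ≤ (π⁻¹ v).val)).card =
      (univ.filter (fun v : Fin n => v.val < t ∧ ¬ t ≤ (π v).val)).card := by
    refine Finset.card_nbij' π.symm π ?_ ?_ ?_ ?_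
    · intro v hv
      simp only [coe_filter, mem_univ, true_and, Set.mem_ofPred_eq] at hv ⊢
      simp only [Equiv.apply_symm_apply]
      have h1 : (π⁻¹ v).val = (π.symm v).val := rfl
      omega
    · intro v hv
      simp only [coe_filter, mem_univ, true_and, Set.mem_ofPred_eq] at hv ⊢
      have h1 : π⁻¹ (π v) = v := by simp
      rw [h1]
      omega
    · intro v hv; simp
    · intro v hv; simp
  unfold kap
  omega

lemma kap_succ (n : ℕ) (t : Fin n) (π : Equiv.Perm (Fin n)) :
    kap n (t.val + 1) π + (if π⁻¹ t < t then 1 else 0) =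
      kap n t.val π + (if t < π t then 1 else 0) := by
  have e1 : kap n (t.val + 1) π = (univ.filter (fun i : Fin n => i < t ∧ t < π i)).card +
      (if t < π t then 1 else 0) := by
    unfold kap
    rw [Finset.card_filter, Finset.card_filter]
    have : (if t < π t then 1 else 0) = ∑ i : Fin n, if i = t then (if t < π t then 1 else 0) else 0 := by
      simp
    rw [this, ← Finset.sum_add_distrib]
    apply Finset.sum_congr rfl
    intro i _
    by_cases hi : i = t
    · subst hi
      simp
    · have hi' : i.val ≠ t.val := fun h => hi (Fin.ext h)
      have : (i.val < t.val + 1 ∧ t.val + 1 ≤ (π i).val) ↔ (i < t ∧ t < π i) := by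
        rw [Fin.lt_def, Fin.lt_def]; omega
      simp only [this, hi, if_false, add_zero]
  have e2 : kap n t.val π = (univ.filter (fun i : Fin n => i < t ∧ t < π i)).card +
      (if π⁻¹ t < t then 1 else 0) := by
    unfold kap
    rw [Finset.card_filter, Finset.card_filter]
    have : (if π⁻¹ t < t then 1 else 0) =
        ∑ i : Fin n, if i = π⁻¹ t then (if π⁻¹ t < t then 1 else 0) else 0 := by
      rw [Finset.sum_ite_eq' univ (π⁻¹ t) (fun _ => (if π⁻¹ t < t then 1 else 0))]
      simp only [mem_univ, if_true]
    rw [this, ← Finset.sum_add_distrib]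
    apply Finset.sum_congr rfl
    intro i _
    by_cases hi : i = π⁻¹ t
    · have hi2 : π i = t := by rw [hi]; simp
      simp only [← hi, hi2, if_true, lt_irrefl, and_false, if_false, le_refl, and_true, Fin.lt_def,
        zero_add]
    · have hi' : (π i).val ≠ t.val := fun h => hi (by
          rw [Equiv.Perm.eq_inv_iff_eq]; exact Fin.ext h)
      have : (i.val < t.val ∧ t.val ≤ (π i).val) ↔ (i < t ∧ t < π i) := by
        rw [Fin.lt_def, Fin.lt_def]; omega
      simp only [this, hi, if_false, add_zero]
  omega

/-- agreement on the square -/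
def agree2 (n : ℕ) (t : Fin n) (π π0 : Equiv.Perm (Fin n)) : Prop :=
  ∀ i j, i < t → j < t → (π i = j ↔ π0 i = j)

lemma agree2_equiv (n : ℕ) (t : Fin n) : Equivalence (agree2 n t) where
  refl := fun _ _ _ _ _ => Iff.rfl
  symm := fun h i j hi hj => (h i j hi hj).symm
  trans := fun h h' i j hi hj => (h i j hi hj).trans (h' i j hi hj)

lemma agree2_of_agree1 {n : ℕ} {t : Fin n} {π π0 : Equiv.Perm (Fin n)} (h : agree1 n t π π0) :
    agree2 n t π π0 := by
  intro i j hi hj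
  rw [h i hi]

lemma agree2_of_agree1_inv {n : ℕ} {t : Fin n} {π π0 : Equiv.Perm (Fin n)}
    (h : agree1 n t π⁻¹ π0⁻¹) : agree2 n t π π0 := by
  intro i j hi hj
  have := h j hj
  rw [← Equiv.Perm.eq_inv_iff_eq, this, Equiv.Perm.eq_inv_iff_eq]

lemma agree2_inv {n : ℕ} {t : Fin n} {π π0 : Equiv.Perm (Fin n)} (h : agree2 n t π π0) :
    agree2 n t π⁻¹ π0⁻¹ := by
  intro i j hi hj
  rw [Equiv.Perm.inv_eq_iff_eq, Equiv.Perm.inv_eq_iff_eq, eq_comm, h j i hj hi, eq_comm]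

lemma agree2_head {n : ℕ} {t : Fin n} {π π0 : Equiv.Perm (Fin n)} (h : agree2 n t π π0)
    (i : Fin n) (hi : i < t) : t ≤ π i ↔ t ≤ π0 i := by
  rw [← not_lt, ← not_lt, not_iff_not]
  constructor
  · intro h1
    rw [(h i (π i) hi h1).mp rfl]; exact h1
  · intro h1
    rw [(h i (π0 i) hi h1).mpr rfl]; exact h1

lemma agree2_step {n : ℕ} {t : Fin n} {π π0 : Equiv.Perm (Fin n)} (h : agree2 n t π π0)
    (i : Fin n) (hi : i < t) (hi' : π0 i < t) : π i = π0 i :=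
  (h i (π0 i) hi hi').mpr rfl

lemma agree2_heads {n : ℕ} {t : Fin n} {π π0 : Equiv.Perm (Fin n)} (h : agree2 n t π π0)
    (u : ℕ) (hu : u ≤ t.val) : univ.filter (fun v : Fin n => v.val < u ∧ t ≤ π v) =
      univ.filter (fun v : Fin n => v.val < u ∧ t ≤ π0 v) := by
  ext i
  simp only [mem_filter, mem_univ, true_and]
  apply and_congr_right
  intro hi
  exact agree2_head h i (Fin.lt_def.mpr (lt_of_lt_of_le hi hu))

lemma agree2_kap {n : ℕ} {t : Fin n} {π π0 : Equiv.Perm (Fin n)} (h : agree2 n t π π0) :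
    kap n t.val π = kap n t.val π0 := by
  have := agree2_heads h t.val le_rfl
  exact congrArg Finset.card this

/-- total weight of an event in the atom -/
def aw (n : ℕ) (q : ℝ) (t : Fin n) (π0 : Equiv.Perm (Fin n)) (P : Equiv.Perm (Fin n) → Prop) : ℝ :=
  ∑ π with agree2 n t π π0 ∧ P π, wt n q π

lemma aw_split (n : ℕ) (q : ℝ) (t : Fin n) (π0 : Equiv.Perm (Fin n))
    (P R : Equiv.Perm (Fin n) → Prop) :
    aw n q t π0 P = aw n q t π0 (fun π => P π ∧ R π) + aw n q t π0 (fun π => P π ∧ ¬ R π) := by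
  unfold aw
  rw [← Finset.sum_filter_add_sum_filter_not _ R, Finset.filter_filter, Finset.filter_filter]
  simp only [and_assoc]

lemma aw_mono (n : ℕ) (q : ℝ) (hq : 0 < q) (t : Fin n) (π0 : Equiv.Perm (Fin n))
    (P R : Equiv.Perm (Fin n) → Prop) (h : ∀ π, agree2 n t π π0 → P π → R π) :
    aw n q t π0 P ≤ aw n q t π0 R := by
  unfold aw
  apply Finset.sum_le_sum_of_subset_of_nonneg
  · intro π
    simp only [mem_filter, mem_univ, true_and]
    exact fun hh => ⟨hh.1, h π hh.1 hh.2⟩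
  · intro π _ _
    exact pow_nonneg hq.le _

lemma aw_congr (n : ℕ) (q : ℝ) (t : Fin n) (π0 : Equiv.Perm (Fin n))
    (P R : Equiv.Perm (Fin n) → Prop) (h : ∀ π, agree2 n t π π0 → (P π ↔ R π)) :
    aw n q t π0 P = aw n q t π0 R := by
  unfold aw
  apply Finset.sum_congr _ (fun _ _ => rfl)
  ext π
  simp only [mem_filter, mem_univ, true_and]
  exact and_congr_right (h π)

lemma aw_nonneg (n : ℕ) (q : ℝ) (hq : 0 < q) (t : Fin n) (π0 : Equiv.Perm (Fin n))
    (P : Equiv.Perm (Fin n) → Prop) : 0 ≤ aw n q t π0 P :=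
  Finset.sum_nonneg fun _ _ => pow_nonneg hq.le _

lemma aw_inv_lt (n : ℕ) (q : ℝ) (t : Fin n) (π0 : Equiv.Perm (Fin n)) (u : ℕ) (hu : u ≤ t.val) :
    aw n q t π0 (fun π => (π⁻¹ t).val < u) * gs q (n - t.val) =
      gs q (univ.filter (fun v : Fin n => v.val < u ∧ t ≤ π0 v)).card *
        aw n q t π0 (fun _ => True) := by
  have := one_sided_Q_inv n q t u _ (fun π => agree2 n t π π0)
    (fun π π1 h1 h2 => (agree2_equiv n t).trans (agree2_of_agree1_inv h1) h2)
    (fun π h => congrArg Finset.card (agree2_heads h u hu))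
  unfold aw
  simp only [and_true]
  exact this

lemma aw_lt (n : ℕ) (q : ℝ) (t : Fin n) (π0 : Equiv.Perm (Fin n)) (u c : ℕ)
    (P : Equiv.Perm (Fin n) → Prop)
    (hP : ∀ π π0, agree1 n t π π0 → P π0 → P π)
    (hc : ∀ π, agree2 n t π π0 → P π →
      (univ.filter (fun v : Fin n => v.val < u ∧ t ≤ π⁻¹ v)).card = c) :
    aw n q t π0 (fun π => P π ∧ (π t).val < u) * gs q (n - t.val) =
      gs q c * aw n q t π0 P := by
  have := one_sided_Q n q t u c (fun π => agree2 n t π π0 ∧ P π)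
    (fun π π1 h1 h2 => ⟨(agree2_equiv n t).trans (agree2_of_agree1 h1) h2.1, hP π π1 h1 h2.2⟩)
    (fun π h => hc π h.1 h.2)
  unfold aw
  simp only [and_assoc] at this ⊢
  convert this using 2
  exact Finset.sum_congr (by ext π; simp) (fun _ _ => rfl)

lemma gs_succ (q : ℝ) (m : ℕ) : gs q (m + 1) = gs q m + q ^ m := Finset.sum_range_succ _ _

lemma aw_inv_eq (n : ℕ) (q : ℝ) (t : Fin n) (π0 : Equiv.Perm (Fin n)) (h : Fin n) (ht : h < t)
    (hh : t ≤ π0 h) :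
    aw n q t π0 (fun π => π⁻¹ t = h) * gs q (n - t.val) =
      q ^ (univ.filter (fun v : Fin n => v.val < h.val ∧ t ≤ π0 v)).card *
        aw n q t π0 (fun _ => True) := by
  have h1 := aw_inv_lt n q t π0 h.val (le_of_lt ht)
  have h2 := aw_inv_lt n q t π0 (h.val + 1) ht
  have e : (univ.filter (fun v : Fin n => v.val < h.val + 1 ∧ t ≤ π0 v)).card =
      (univ.filter (fun v : Fin n => v.val < h.val ∧ t ≤ π0 v)).card + 1 := by
    rw [← Finset.card_insert_of_notMem (a := h)]
    · congr 1
      ext x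
      simp only [mem_filter, mem_univ, true_and, mem_insert]
      constructor
      · rintro ⟨a, b⟩
        by_cases hx : x = h
        · exact Or.inl hx
        · have : x.val ≠ h.val := fun h => hx (Fin.ext h)
          exact Or.inr ⟨by omega, b⟩
      · rintro (rfl | ⟨a, b⟩)
        · exact ⟨by omega, hh⟩
        · exact ⟨by omega, b⟩
    · simp
  rw [e, gs_succ] at h2
  have h3 := aw_split n q t π0 (fun π => (π⁻¹ t).val < h.val + 1) (fun π => (π⁻¹ t).val < h.val)
  rw [aw_congr n q t π0 (fun π => (π⁻¹ t).val < h.val + 1 ∧ (π⁻¹ t).val < h.val)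
      (fun π => (π⁻¹ t).val < h.val) (fun π _ => by omega),
    aw_congr n q t π0 (fun π => (π⁻¹ t).val < h.val + 1 ∧ ¬ (π⁻¹ t).val < h.val)
      (fun π => π⁻¹ t = h) (fun π _ => by rw [Fin.ext_iff]; omega)] at h3
  rw [h3] at h2
  linear_combination h2 - h1

lemma aw_eq (n : ℕ) (q : ℝ) (t : Fin n) (π0 : Equiv.Perm (Fin n)) (g : Fin n) (ht : g < t)
    (hg : t ≤ π0⁻¹ g) (P : Equiv.Perm (Fin n) → Prop)
    (hP : ∀ π π0, agree1 n t π π0 → P π0 → P π) :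
    aw n q t π0 (fun π => P π ∧ π t = g) * gs q (n - t.val) =
      q ^ (univ.filter (fun v : Fin n => v.val < g.val ∧ t ≤ π0⁻¹ v)).card *
        aw n q t π0 P := by
  have h1 := aw_lt n q t π0 g.val _ P hP
    (fun π h _ => congrArg Finset.card (agree2_heads (agree2_inv h) g.val (le_of_lt ht)))
  have h2 := aw_lt n q t π0 (g.val + 1) _ P hP
    (fun π h _ => congrArg Finset.card (agree2_heads (agree2_inv h) (g.val + 1) ht))
  have e : (univ.filter (fun v : Fin n => v.val < g.val + 1 ∧ t ≤ π0⁻¹ v)).card =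
      (univ.filter (fun v : Fin n => v.val < g.val ∧ t ≤ π0⁻¹ v)).card + 1 := by
    rw [← Finset.card_insert_of_notMem (a := g)]
    · congr 1
      ext x
      simp only [mem_filter, mem_univ, true_and, mem_insert]
      constructor
      · rintro ⟨a, b⟩
        by_cases hx : x = g
        · exact Or.inl hx
        · have : x.val ≠ g.val := fun h => hx (Fin.ext h)
          exact Or.inr ⟨by omega, b⟩
      · rintro (rfl | ⟨a, b⟩)
        · exact ⟨by omega, hg⟩
        · exact ⟨by omega, b⟩
    · simp
  rw [e, gs_succ] at h2
  have h3 := aw_split n q t π0 (fun π => P π ∧ (π t).val < g.val + 1) (fun π => (π t).val < g.val)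
  rw [aw_congr n q t π0 (fun π => (P π ∧ (π t).val < g.val + 1) ∧ (π t).val < g.val)
      (fun π => P π ∧ (π t).val < g.val) (fun π _ => ⟨fun x => ⟨x.1.1, x.2⟩,
        fun x => ⟨⟨x.1, by omega⟩, x.2⟩⟩),
    aw_congr n q t π0 (fun π => (P π ∧ (π t).val < g.val + 1) ∧ ¬ (π t).val < g.val)
      (fun π => P π ∧ π t = g) (fun π _ => by
        rw [Fin.ext_iff]
        exact ⟨fun x => ⟨x.1.1, by omega⟩, fun x => ⟨⟨x.1, by omega⟩, by omega⟩⟩)] at h3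
  rw [h3] at h2
  linear_combination h2 - h1

lemma aw_close (n : ℕ) (q : ℝ) (t : Fin n) (π0 : Equiv.Perm (Fin n)) (h g : Fin n) (ht : h < t)
    (hh : t ≤ π0 h) (hgt : g < t) (hg : t ≤ π0⁻¹ g) :
    ∃ a b : ℕ, a + 1 ≤ kap n t.val π0 ∧ b + 1 ≤ kap n t.val π0 ∧
    aw n q t π0 (fun π => π h = t ∧ π t = g) * gs q (n - t.val) ^ 2 =
      q ^ (a + b) * aw n q t π0 (fun _ => True) := by
  refine ⟨(univ.filter (fun v : Fin n => v.val < h.val ∧ t ≤ π0 v)).card,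
    (univ.filter (fun v : Fin n => v.val < g.val ∧ t ≤ π0⁻¹ v)).card, ?_, ?_, ?_⟩
  rotate_left 2
  · have h1 := aw_inv_eq n q t π0 h ht hh
    have h2 := aw_eq n q t π0 g hgt hg (fun π => π⁻¹ t = h) (by
      intro π π1 h1 h2
      rw [Equiv.Perm.inv_eq_iff_eq] at h2 ⊢
      rw [h1 h ht]; exact h2)
    rw [aw_congr n q t π0 (fun π => π⁻¹ t = h ∧ π t = g) (fun π => π h = t ∧ π t = g)
      (fun π _ => by rw [Equiv.Perm.inv_eq_iff_eq, eq_comm (a := t)])] at h2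
    rw [pow_add, sq, ← mul_assoc, h2, mul_assoc, h1]
    ring
  · rw [kap]
    apply Finset.card_lt_card
    rw [Finset.ssubset_iff_of_subset]
    · exact ⟨h, by simpa using ⟨ht, hh⟩, by simp⟩
    · intro x
      simp only [mem_filter, mem_univ, true_and]
      intro hx
      exact ⟨lt_trans hx.1 ht, hx.2⟩
  · rw [← kap_tail]
    apply Finset.card_lt_card
    rw [Finset.ssubset_iff_of_subset]
    · exact ⟨g, by simpa using ⟨hgt, hg⟩, by simp⟩
    · intro x
      simp only [mem_filter, mem_univ, true_and]
      intro hx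
      exact ⟨lt_trans hx.1 hgt, hx.2⟩

lemma aw_down (n : ℕ) (q : ℝ) (t : Fin n) (π0 : Equiv.Perm (Fin n)) :
    aw n q t π0 (fun π => π⁻¹ t < t ∧ π t < t) * gs q (n - t.val) ^ 2 =
      gs q (kap n t.val π0) ^ 2 * aw n q t π0 (fun _ => True) := by
  have h1 := aw_inv_lt n q t π0 t.val le_rfl
  have h2 := aw_lt n q t π0 t.val (kap n t.val π0) (fun π => π⁻¹ t < t) (by
      intro π π1 h1 h2
      rw [← not_le] at h2 ⊢
      rwa [agree1_inv h1])
    (fun π h _ => by rw [← agree2_kap h]; exact kap_tail n t.val π)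
  change aw n q t π0 (fun π => π⁻¹ t < t) * gs q (n - t.val) =
      gs q (kap n t.val π0) * aw n q t π0 (fun _ => True) at h1
  change aw n q t π0 (fun π => π⁻¹ t < t ∧ π t < t) * gs q (n - t.val) =
      gs q (kap n t.val π0) * aw n q t π0 (fun π => π⁻¹ t < t) at h2
  rw [sq, ← mul_assoc, h2, mul_assoc, h1]
  ring

lemma aw_up (n : ℕ) (q : ℝ) (t : Fin n) (π0 : Equiv.Perm (Fin n)) :
    0 ≤ 1 ∧ aw n q t π0 (fun π => ¬ π⁻¹ t < t) * gs q (n - t.val) =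
      (gs q (n - t.val) - gs q (kap n t.val π0)) * aw n q t π0 (fun _ => True) ∧
    aw n q t π0 (fun π => ¬ π⁻¹ t < t ∧ t < π t) * gs q (n - t.val) =
      (gs q (n - t.val) - gs q (kap n t.val π0 + 1)) * aw n q t π0 (fun π => ¬ π⁻¹ t < t) := by
  have h1 := aw_inv_lt n q t π0 t.val le_rfl
  change aw n q t π0 (fun π => π⁻¹ t < t) * gs q (n - t.val) =
      gs q (kap n t.val π0) * aw n q t π0 (fun _ => True) at h1
  have h2 := aw_lt n q t π0 (t.val + 1) (kap n t.val π0 + 1) (fun π => ¬ π⁻¹ t < t) (by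
      intro π π1 h1 h2
      rw [not_lt] at h2 ⊢
      rwa [agree1_inv h1])
    (fun π h hh => by
      rw [← agree2_kap h, ← kap_tail, ← Finset.card_insert_of_notMem (a := t)]
      · congr 1
        ext x
        simp only [mem_filter, mem_univ, true_and, mem_insert]
        constructor
        · rintro ⟨a, b⟩
          by_cases hx : x = t
          · exact Or.inl hx
          · have : x.val ≠ t.val := fun h => hx (Fin.ext h)
            exact Or.inr ⟨by omega, b⟩
        · rintro (rfl | ⟨a, b⟩)
          · exact ⟨by omega, not_lt.mp hh⟩
          · exact ⟨by omega, b⟩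
      · simp)
  have h3 := aw_split n q t π0 (fun _ => True) (fun π => π⁻¹ t < t)
  have h4 := aw_split n q t π0 (fun π => ¬ π⁻¹ t < t) (fun π => (π t).val < t.val + 1)
  rw [aw_congr n q t π0 (fun π => ¬ π⁻¹ t < t ∧ ¬ (π t).val < t.val + 1)
    (fun π => ¬ π⁻¹ t < t ∧ t < π t) (fun π _ => by
      rw [Fin.lt_def (a := t) (b := π t)]
      apply and_congr_right
      intro _; omega)] at h4
  simp only [true_and] at h3
  refine ⟨zero_le_one, ?_, ?_⟩
  · linear_combination (-gs q (n - t.val)) * h3 - h1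
  · linear_combination (-gs q (n - t.val)) * h4 - h2

/-- the cycle of `s` reaches level `t` -/
def opn (n t : ℕ) (s : Fin n) (π : Equiv.Perm (Fin n)) : Prop :=
  ∃ x : Fin n, π.SameCycle s x ∧ t ≤ x.val

lemma path_exists {n : ℕ} (t s : Fin n) (π : Equiv.Perm (Fin n)) (hs : s < t)
    (ho : opn n t.val s π) : ∃ j : ℕ, (∀ i ≤ j, (π ^ i) s < t) ∧ t ≤ (π ^ (j + 1)) s := by
  obtain ⟨x, hx, htx⟩ := ho
  obtain ⟨m, hm⟩ := hx.exists_nat_pow_eq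
  have hex : ∃ m : ℕ, t ≤ (π ^ m) s := ⟨m, by rw [hm]; exact htx⟩
  have h1 := Nat.find_spec hex
  have h2 : ∀ i, i < Nat.find hex → ¬ t ≤ (π ^ i) s := fun i hi => Nat.find_min hex hi
  generalize Nat.find hex = N at h1 h2
  cases N with
  | zero => simp at h1; exact absurd hs (not_lt.mpr h1)
  | succ j => exact ⟨j, fun i hi => not_le.mp (h2 i (by omega)), h1⟩

lemma path_agree {n : ℕ} (t s : Fin n) (π π0 : Equiv.Perm (Fin n)) (h : agree2 n t π π0) (j : ℕ)
    (hj : ∀ i ≤ j, (π0 ^ i) s < t) : ∀ i ≤ j, (π ^ i) s = (π0 ^ i) s := by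
  intro i
  induction i with
  | zero => simp
  | succ i ih =>
    intro hi
    rw [pow_succ', pow_succ', Equiv.Perm.mul_apply, Equiv.Perm.mul_apply, ih (by omega)]
    apply agree2_step h _ (hj i (by omega))
    have := hj (i + 1) hi
    rwa [pow_succ', Equiv.Perm.mul_apply] at this

lemma opn_inv {n t : ℕ} {s : Fin n} {π : Equiv.Perm (Fin n)} (h : opn n t s π) : opn n t s π⁻¹ := by
  obtain ⟨x, hx, h⟩ := h
  exact ⟨x, Equiv.Perm.sameCycle_inv.mpr hx, h⟩

lemma structure_lemma {n : ℕ} (t s : Fin n) (π0 : Equiv.Perm (Fin n)) (hs : s < t)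
    (ho : opn n t.val s π0) :
    ∃ h g : Fin n, h < t ∧ t ≤ π0 h ∧ g < t ∧ t ≤ π0⁻¹ g ∧ ∀ π, agree2 n t π π0 →
      opn n t.val s π ∧ (¬ opn n (t.val + 1) s π ↔ π h = t ∧ π t = g) := by
  obtain ⟨j, hj, hj1⟩ := path_exists t s π0 hs ho
  obtain ⟨j', hj', hj1'⟩ := path_exists t s π0⁻¹ hs (opn_inv ho)
  rw [pow_succ', Equiv.Perm.mul_apply] at hj1 hj1'
  refine ⟨(π0 ^ j) s, (π0⁻¹ ^ j') s, hj j le_rfl, hj1, hj' j' le_rfl, hj1', ?_⟩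
  intro π hπ
  have e1 := path_agree t s π π0 hπ j hj
  have e2 := path_agree t s π⁻¹ π0⁻¹ (agree2_inv hπ) j' hj'
  have a1 : t ≤ π ((π ^ j) s) := by
    rw [e1 j le_rfl, agree2_head hπ _ (hj j le_rfl)]; exact hj1
  have a2 : t ≤ π⁻¹ ((π⁻¹ ^ j') s) := by
    rw [e2 j' le_rfl, agree2_head (agree2_inv hπ) _ (hj' j' le_rfl)]; exact hj1'
  have c1 : π.SameCycle s (π ((π ^ j) s)) :=
    ⟨(j : ℤ) + 1, by rw [add_comm, zpow_add, zpow_one, zpow_natCast, Equiv.Perm.mul_apply]⟩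
  have c2 : π.SameCycle s (π⁻¹ ((π⁻¹ ^ j') s)) := by
    rw [← Equiv.Perm.sameCycle_inv]
    exact ⟨(j' : ℤ) + 1, by rw [add_comm, zpow_add, zpow_one, zpow_natCast, Equiv.Perm.mul_apply]⟩
  refine ⟨⟨_, c1, a1⟩, ?_⟩
  rw [← e1 j le_rfl, ← e2 j' le_rfl]
  constructor
  · intro hno
    have hle : ∀ x, π.SameCycle s x → x ≤ t := by
      intro x hx
      by_contra hc
      exact hno ⟨x, hx, by rw [not_le, Fin.lt_def] at hc; omega⟩
    refine ⟨le_antisymm (hle _ c1) a1, ?_⟩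
    have := le_antisymm (hle _ c2) a2
    rw [← this]; simp
  · rintro ⟨b1, b2⟩ ⟨x, hx, hxt⟩
    obtain ⟨m, rfl⟩ := hx.exists_nat_pow_eq
    have key : ∀ m : ℕ, (∃ i ≤ j, (π ^ m) s = (π ^ i) s) ∨ (∃ i ≤ j', (π ^ m) s = (π⁻¹ ^ i) s) ∨
        (π ^ m) s = t := by
      intro m
      induction m with
      | zero => exact Or.inl ⟨0, by omega, rfl⟩
      | succ m ih =>
        rw [pow_succ', Equiv.Perm.mul_apply]
        rcases ih with ⟨i, hi, h⟩ | ⟨i, hi, h⟩ | h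
        · rw [h]
          by_cases hij : i = j
          · subst hij; exact Or.inr (Or.inr b1)
          · exact Or.inl ⟨i + 1, by omega, by rw [pow_succ', Equiv.Perm.mul_apply]⟩
        · rw [h]
          cases i with
          | zero =>
            by_cases hij : j = 0
            · subst hij
              exact Or.inr (Or.inr b1)
            · exact Or.inl ⟨1, by omega, by simp⟩
          | succ i =>
            exact Or.inr (Or.inl ⟨i, by omega, by rw [pow_succ', Equiv.Perm.mul_apply]; simp⟩)
        · rw [h]
          exact Or.inr (Or.inl ⟨j', le_rfl, b2⟩)
    rcases key m with ⟨i, hi, h⟩ | ⟨i, hi, h⟩ | h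
    · rw [h, e1 i hi] at hxt
      have := hj i hi
      rw [Fin.lt_def] at this; omega
    · rw [h, e2 i hi] at hxt
      have := hj' i hi
      rw [Fin.lt_def] at this; omega
    · rw [h] at hxt; omega

lemma opn_mono {n t t' : ℕ} (h : t ≤ t') {s : Fin n} {π : Equiv.Perm (Fin n)} (ho : opn n t' s π) :
    opn n t s π := by
  obtain ⟨x, hx, h'⟩ := ho
  exact ⟨x, hx, h.trans h'⟩

lemma close_unique {n : ℕ} (t : Fin n) (π π1 : Equiv.Perm (Fin n)) (h : agree1 n t π π1)
    (h1 : ¬ opn n (t.val + 1) t π) (h2 : ¬ opn n (t.val + 1) t π1) : π t = π1 t := by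
  have hle : ∀ π : Equiv.Perm (Fin n), ¬ opn n (t.val + 1) t π → ∀ x, π.SameCycle t x → x ≤ t := by
    intro π hno x hx
    by_contra hc
    exact hno ⟨x, hx, by rw [not_le, Fin.lt_def] at hc; omega⟩
  have hc0 : π1.SameCycle t (π1 t) := ⟨1, by simp⟩
  obtain ⟨m, hm⟩ := hc0.symm.exists_nat_pow_eq
  have hex : ∃ m : ℕ, (π1 ^ m) (π1 t) = t := ⟨m, hm⟩
  have f1 := Nat.find_spec hex
  have f2 : ∀ i, i < Nat.find hex → (π1 ^ i) (π1 t) ≠ t := fun i hi => Nat.find_min hex hi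
  generalize Nat.find hex = N at f1 f2
  have f3 : ∀ i, i < N → (π1 ^ i) (π1 t) < t := by
    intro i hi
    refine lt_of_le_of_ne (hle π1 h2 _ ?_) (f2 i hi)
    exact hc0.trans ⟨i, by simp⟩
  have f4 : ∀ i ≤ N, (π ^ i) (π1 t) = (π1 ^ i) (π1 t) := by
    intro i
    induction i with
    | zero => simp
    | succ i ih =>
      intro hi
      rw [pow_succ', pow_succ', Equiv.Perm.mul_apply, Equiv.Perm.mul_apply, ih (by omega)]
      exact h _ (f3 i (by omega))
  have f5 : π.SameCycle (π1 t) t := ⟨N, by rw [zpow_natCast, f4 N le_rfl, f1]⟩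
  have f6 : π.SameCycle t (π⁻¹ (π1 t)) := f5.symm.trans ⟨-1, by simp⟩
  have f7 := hle π h1 _ f6
  rcases lt_or_eq_of_le f7 with f8 | f8
  · have := h _ f8
    have f9 : π (π⁻¹ (π1 t)) = π1 t := by simp
    rw [f9] at this
    rw [← π1.injective this] at f8
    exact absurd f8 (lt_irrefl _)
  · rw [Equiv.Perm.inv_eq_iff_eq] at f8
    exact f8.symm

lemma one_sided_eq (n : ℕ) (q : ℝ) (t : Fin n) (π0 : Equiv.Perm (Fin n)) (g : Fin n)
    (hg : t ≤ π0⁻¹ g) : ∃ a : ℕ,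
    (∑ π with agree1 n t π π0 ∧ π t = g, wt n q π) * gs q (n - t.val) =
      q ^ a * ∑ π with agree1 n t π π0, wt n q π := by
  have h1 := one_sided n q t π0 g.val
  have h2 := one_sided n q t π0 (g.val + 1)
  have e : (univ.filter (fun v : Fin n => v.val < g.val + 1 ∧ t ≤ π0⁻¹ v)).card =
      (univ.filter (fun v : Fin n => v.val < g.val ∧ t ≤ π0⁻¹ v)).card + 1 := by
    rw [← Finset.card_insert_of_notMem (a := g)]
    · congr 1
      ext x
      simp only [mem_filter, mem_univ, true_and, mem_insert]
      constructor
      · rintro ⟨a, b⟩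
        by_cases hx : x = g
        · exact Or.inl hx
        · have : x.val ≠ g.val := fun h => hx (Fin.ext h)
          exact Or.inr ⟨by omega, b⟩
      · rintro (rfl | ⟨a, b⟩)
        · exact ⟨by omega, hg⟩
        · exact ⟨by omega, b⟩
    · simp
  rw [e, gs_succ] at h2
  refine ⟨(univ.filter (fun v : Fin n => v.val < g.val ∧ t ≤ π0⁻¹ v)).card, ?_⟩
  have h3 : ∑ π with agree1 n t π π0 ∧ (π t).val < g.val + 1, wt n q π =
      ∑ π with agree1 n t π π0 ∧ (π t).val < g.val, wt n q π +
      ∑ π with agree1 n t π π0 ∧ π t = g, wt n q π := by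
    rw [← Finset.sum_union]
    · apply Finset.sum_congr _ (fun _ _ => rfl)
      ext π
      simp only [mem_filter, mem_univ, true_and, mem_union, Fin.ext_iff, ← and_or_left]
      apply and_congr_right
      intro _
      omega
    · rw [Finset.disjoint_filter]
      rintro π - ⟨_, a⟩ ⟨_, b⟩
      rw [b] at a; omega
  rw [h3] at h2
  linear_combination h2 - h1

lemma gs_mul (q : ℝ) (m : ℕ) : gs q m * (1 - q) = 1 - q ^ m := by
  induction m with
  | zero => simp [gs]
  | succ m ih => rw [gs_succ, add_mul, ih]; ring

lemma gs_ge_one {q : ℝ} (hq : 0 < q) {m : ℕ} (hm : 1 ≤ m) : 1 ≤ gs q m := by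
  obtain ⟨k, rfl⟩ : ∃ k, m = k + 1 := ⟨m - 1, by omega⟩
  rw [gs, Finset.sum_range_succ', pow_zero]
  have : 0 ≤ ∑ i ∈ range k, q ^ (i + 1) := Finset.sum_nonneg fun _ _ => by positivity
  linarith

lemma gs_ge_two {q : ℝ} (hq : 0 < q) {m : ℕ} (hm : 2 ≤ m) : 1 + q ≤ gs q m := by
  obtain ⟨k, rfl⟩ : ∃ k, m = k + 1 + 1 := ⟨m - 2, by omega⟩
  rw [gs, Finset.sum_range_succ', Finset.sum_range_succ', pow_zero, zero_add, pow_one]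
  have : 0 ≤ ∑ i ∈ range k, q ^ (i + 1 + 1) := Finset.sum_nonneg fun _ _ => by positivity
  linarith

lemma gs_ge_mul {q : ℝ} (hq : 0 < q) (hq1 : q < 1) (m : ℕ) : m * q ^ m ≤ gs q m := by
  rw [gs]
  have : ∑ i ∈ range m, q ^ m ≤ ∑ i ∈ range m, q ^ i := by
    apply Finset.sum_le_sum
    intro i hi
    exact pow_le_pow_of_le_one hq.le hq1.le (Finset.mem_range.mp hi).le
  simpa using this

lemma wt_pos {n : ℕ} {q : ℝ} (hq : 0 < q) (π : Equiv.Perm (Fin n)) : 0 < wt n q π := pow_pos hq _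

lemma aw_ind (n : ℕ) (q : ℝ) (t : Fin n) (π0 : Equiv.Perm (Fin n))
    (P : Equiv.Perm (Fin n) → Prop) :
    aw n q t π0 P = ∑ π with agree2 n t π π0, wt n q π * (if P π then 1 else 0) := by
  unfold aw
  rw [← Finset.filter_filter, Finset.sum_filter]
  apply Finset.sum_congr rfl
  intro π _
  split_ifs <;> simp

lemma drift (n : ℕ) (q : ℝ) (t : Fin n) (π0 : Equiv.Perm (Fin n)) (F : ℕ → ℝ) :
    ∑ π with agree2 n t π π0, wt n q π * F (kap n (t.val + 1) π) =
      aw n q t π0 (fun _ => True) * F (kap n t.val π0) +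
      aw n q t π0 (fun π => ¬ π⁻¹ t < t ∧ t < π t) *
        (F (kap n t.val π0 + 1) - F (kap n t.val π0)) +
      aw n q t π0 (fun π => π⁻¹ t < t ∧ π t < t) *
        (F (kap n t.val π0 - 1) - F (kap n t.val π0)) := by
  rw [aw_ind, aw_ind, aw_ind, Finset.sum_mul, Finset.sum_mul, Finset.sum_mul,
    ← Finset.sum_add_distrib, ← Finset.sum_add_distrib]
  apply Finset.sum_congr rfl
  intro π hπ
  have hk := agree2_kap (mem_filter.mp hπ).2
  have hs := kap_succ n t π
  rw [hk] at hs
  by_cases h1 : π⁻¹ t < t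
  · by_cases h2 : π t < t
    · have h3 : ¬ t < π t := not_lt.mpr h2.le
      simp only [h1, h3, if_true, if_false] at hs
      have : kap n (t.val + 1) π = kap n t.val π0 - 1 := by omega
      rw [this]
      simp only [h1, h2, not_true, false_and, true_and, if_true, if_false]
      ring
    · have h3 : t < π t := by
        refine lt_of_le_of_ne (not_lt.mp h2) ?_
        intro h
        have : π⁻¹ t = t := by rw [Equiv.Perm.inv_eq_iff_eq]; exact h
        rw [this] at h1
        exact lt_irrefl _ h1
      simp only [h1, h3, if_true] at hs
      have : kap n (t.val + 1) π = kap n t.val π0 := by omega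
      rw [this]
      simp only [h1, h2, not_true, false_and, and_false, if_true, if_false]
      ring
  · by_cases h3 : t < π t
    · simp only [h1, h3, if_true, if_false] at hs
      have : kap n (t.val + 1) π = kap n t.val π0 + 1 := by omega
      rw [this]
      simp only [h1, h3, not_false_iff, false_and, true_and, if_true, if_false]
      ring
    · simp only [h1, h3, if_false] at hs
      have : kap n (t.val + 1) π = kap n t.val π0 := by omega
      rw [this]
      simp only [h1, h3, false_and, and_false, if_true, if_false]
      ring

lemma up_bound (n : ℕ) (q : ℝ) (hq : 0 < q) (hq1 : q < 1) (t : Fin n) (π0 : Equiv.Perm (Fin n)) :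
    aw n q t π0 (fun π => ¬ π⁻¹ t < t ∧ t < π t) ≤
      q ^ (2 * kap n t.val π0 + 1) * aw n q t π0 (fun _ => True) := by
  obtain ⟨-, h1, h2⟩ := aw_up n q t π0
  have hG := gs_ge_one hq (m := n - t.val) (by have := t.isLt; omega)
  have hGm := gs_mul q (n - t.val)
  have hp : 0 < q ^ (n - t.val) := pow_pos hq _
  set G := gs q (n - t.val)
  set k := kap n t.val π0
  have hM := aw_nonneg n q hq t π0 (fun _ => True)
  have hB := aw_nonneg n q hq t π0 (fun π => ¬ π⁻¹ t < t)
  have key : ∀ j, G - gs q j ≤ q ^ j * G := by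
    intro j
    have := gs_mul q j
    have h1q : 0 < 1 - q := by linarith
    have e : (q ^ j * G - (G - gs q j)) * (1 - q) = (1 - q ^ j) * q ^ (n - t.val) := by
      linear_combination (q ^ j - 1) * hGm + this
    have h5 : q ^ j ≤ 1 := pow_le_one₀ hq.le hq1.le
    have h6 : 0 ≤ (q ^ j * G - (G - gs q j)) * (1 - q) := by
      rw [e]; exact mul_nonneg (by linarith) hp.le
    have := nonneg_of_mul_nonneg_left h6 h1q
    linarith
  have hG0 : 0 < G := by linarith
  have b1 : aw n q t π0 (fun π => ¬ π⁻¹ t < t) ≤ q ^ k * aw n q t π0 (fun _ => True) := by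
    have := mul_le_mul_of_nonneg_right (key k) hM
    rw [← h1] at this
    have h' : aw n q t π0 (fun π => ¬ π⁻¹ t < t) * G ≤ (q ^ k * aw n q t π0 (fun _ => True)) * G := by
      linarith
    exact le_of_mul_le_mul_right h' hG0
  have b2 : aw n q t π0 (fun π => ¬ π⁻¹ t < t ∧ t < π t) ≤
      q ^ (k + 1) * aw n q t π0 (fun π => ¬ π⁻¹ t < t) := by
    have := mul_le_mul_of_nonneg_right (key (k + 1)) hB
    rw [← h2] at this
    exact le_of_mul_le_mul_right (by linarith) hG0
  calc _ ≤ _ := b2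
    _ ≤ q ^ (k + 1) * (q ^ k * aw n q t π0 (fun _ => True)) :=
      mul_le_mul_of_nonneg_left b1 (by positivity)
    _ = _ := by ring

lemma down_bound (n : ℕ) (q : ℝ) (hq : 0 < q) (hq1 : q < 1) (t : Fin n)
    (π0 : Equiv.Perm (Fin n)) :
    (1 - q ^ kap n t.val π0) ^ 2 * aw n q t π0 (fun _ => True) ≤
      aw n q t π0 (fun π => π⁻¹ t < t ∧ π t < t) := by
  have h1 := aw_down n q t π0
  have hG := gs_ge_one hq (m := n - t.val) (by have := t.isLt; omega)
  have hGm := gs_mul q (n - t.val)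
  have hp : 0 < q ^ (n - t.val) := pow_pos hq _
  set G := gs q (n - t.val)
  set k := kap n t.val π0
  have hk := gs_mul q k
  have hD := aw_nonneg n q hq t π0 (fun π => π⁻¹ t < t ∧ π t < t)
  rw [← hk]
  calc _ = (1 - q) ^ 2 * (gs q k ^ 2 * aw n q t π0 (fun _ => True)) := by ring
    _ = (G * (1 - q)) ^ 2 * aw n q t π0 (fun π => π⁻¹ t < t ∧ π t < t) := by rw [← h1]; ring
    _ ≤ 1 * _ := by
      apply mul_le_mul_of_nonneg_right _ hD
      apply pow_le_one₀
      · exact mul_nonneg (by linarith) (by linarith)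
      · linarith
    _ = _ := one_mul _

lemma exp_step (n : ℕ) (q : ℝ) (hq : 0 < q) (hq1 : q < 1) (t : Fin n) :
    ∑ π, wt n q π * q⁻¹ ^ kap n (t.val + 1) π ≤
      ∑ π, wt n q π * (q * q⁻¹ ^ kap n t.val π + 2 * (1 - q)) := by
  apply fib_le (agree2 n t) (agree2_equiv n t)
  intro π0
  rw [drift n q t π0 (fun k => q⁻¹ ^ k)]
  have hU := up_bound n q hq hq1 t π0
  have hD := down_bound n q hq hq1 t π0
  have hR : ∑ π with agree2 n t π π0, wt n q π * (q * q⁻¹ ^ kap n t.val π + 2 * (1 - q)) =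
      aw n q t π0 (fun _ => True) * (q * q⁻¹ ^ kap n t.val π0 + 2 * (1 - q)) := by
    rw [aw_ind, Finset.sum_mul]
    apply Finset.sum_congr rfl
    intro π hπ
    rw [agree2_kap (mem_filter.mp hπ).2]
    simp
  rw [hR]
  have hM := aw_nonneg n q hq t π0 (fun _ => True)
  set M := aw n q t π0 (fun _ => True)
  set U := aw n q t π0 (fun π => ¬ π⁻¹ t < t ∧ t < π t)
  set D := aw n q t π0 (fun π => π⁻¹ t < t ∧ π t < t)
  generalize kap n t.val π0 = k at *
  have h1q : 0 < 1 - q := by linarith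
  cases k with
  | zero =>
    simp only [pow_zero, zero_add, pow_one, zero_tsub, sub_self, mul_zero, add_zero, mul_one] at *
    have : U * (q⁻¹ - 1) ≤ q * M * (q⁻¹ - 1) :=
      mul_le_mul_of_nonneg_right hU (by
        have := (one_le_inv₀ hq).mpr hq1.le
        linarith)
    have e : q * M * (q⁻¹ - 1) = M * (1 - q) := by field_simp
    rw [e] at this
    nlinarith
  | succ k =>
    simp only [Nat.add_sub_cancel]
    have hf : 0 < q⁻¹ ^ (k + 1) := by positivity
    have hfx : q⁻¹ ^ (k + 1) * q ^ (k + 1) = 1 := by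
      rw [← mul_pow, inv_mul_cancel₀ hq.ne', one_pow]
    have e1 : q⁻¹ ^ (k + 1 + 1) - q⁻¹ ^ (k + 1) = q⁻¹ ^ (k + 1) * ((1 - q) / q) := by
      rw [pow_succ q⁻¹ (k + 1)]; field_simp
    have e2 : q⁻¹ ^ k - q⁻¹ ^ (k + 1) = - (q⁻¹ ^ (k + 1) * (1 - q)) := by
      rw [pow_succ q⁻¹ k]; field_simp; ring
    rw [e1, e2]
    have e3 : q ^ (2 * (k + 1) + 1) = (q ^ (k + 1)) ^ 2 * q := by ring
    rw [e3] at hU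
    generalize q⁻¹ ^ (k + 1) = f at *
    generalize q ^ (k + 1) = x at *
    have g1 : U * (f * ((1 - q) / q)) ≤ (x ^ 2 * q * M) * (f * ((1 - q) / q)) :=
      mul_le_mul_of_nonneg_right hU (by positivity)
    have g2 : (1 - x) ^ 2 * M * (f * (1 - q)) ≤ D * (f * (1 - q)) :=
      mul_le_mul_of_nonneg_right hD (by positivity)
    have g3 : (x ^ 2 * q * M) * (f * ((1 - q) / q)) = x ^ 2 * M * f * (1 - q) := by
      field_simp
    have g4 : M * f + x ^ 2 * M * f * (1 - q) - (1 - x) ^ 2 * M * (f * (1 - q)) =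
        M * (q * f + 2 * (1 - q)) := by
      linear_combination (2 * M * (1 - q)) * hfx
    linarith

lemma exp_bound (n : ℕ) (q : ℝ) (hq : 0 < q) (hq1 : q < 1) (t : ℕ) (ht : t ≤ n) :
    ∑ π, wt n q π * q⁻¹ ^ kap n t π ≤ 2 * ∑ π, wt n q π := by
  have hZ : 0 ≤ ∑ π, wt n q π := Finset.sum_nonneg fun π _ => (wt_pos hq π).le
  induction t with
  | zero =>
    have : ∀ π, kap n 0 π = 0 := by intro π; simp [kap]
    simp only [this, pow_zero, mul_one]
    linarith
  | succ t ih =>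
    have h1 := ih (by omega)
    have h2 := exp_step n q hq hq1 ⟨t, ht⟩
    have e : ∑ π, wt n q π * (q * q⁻¹ ^ kap n t π + 2 * (1 - q)) =
        q * (∑ π, wt n q π * q⁻¹ ^ kap n t π) + 2 * (1 - q) * ∑ π, wt n q π := by
      rw [Finset.mul_sum, Finset.mul_sum, ← Finset.sum_add_distrib]
      exact Finset.sum_congr rfl fun _ _ => by ring
    simp only [e] at h2
    nlinarith

lemma kap_bound (n : ℕ) (q : ℝ) (hq : 0 < q) (hq1 : q < 1) (t : ℕ) (ht : t ≤ n) :
    ∑ π, wt n q π * (kap n t π : ℝ) ≤ q / (1 - q) * ∑ π, wt n q π := by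
  have h := exp_bound n q hq hq1 t ht
  have h1q : 0 < 1 - q := by linarith
  have b : ∀ k : ℕ, (k : ℝ) * ((1 - q) / q) ≤ q⁻¹ ^ k - 1 := by
    intro k
    have := one_add_mul_le_pow (a := (1 - q) / q) (by
      have : 0 ≤ (1 - q) / q := by positivity
      linarith) k
    have e : 1 + (1 - q) / q = q⁻¹ := by field_simp; ring
    rw [e] at this
    linarith
  have h2 : (∑ π, wt n q π * (kap n t π : ℝ)) * ((1 - q) / q) ≤ ∑ π, wt n q π := by
    rw [Finset.sum_mul]
    calc _ ≤ ∑ π, (wt n q π * q⁻¹ ^ kap n t π - wt n q π) := by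
          apply Finset.sum_le_sum
          intro π _
          have := mul_le_mul_of_nonneg_left (b (kap n t π)) (wt_pos hq π).le
          linarith
      _ ≤ _ := by rw [Finset.sum_sub_distrib]; linarith
  rw [← le_div_iff₀ (by positivity)] at h2
  refine h2.trans (le_of_eq ?_)
  field_simp

lemma not_open_atom {n : ℕ} (t s : Fin n) (π0 π : Equiv.Perm (Fin n)) (hs : s < t)
    (ho : ¬ opn n t.val s π0) (h : agree2 n t π π0) : ¬ opn n t.val s π := by
  intro h1
  obtain ⟨_, _, -, -, -, -, hh⟩ := structure_lemma t s π hs h1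
  exact ho (hh π0 ((agree2_equiv n t).symm h)).1

lemma D2 (n : ℕ) (q : ℝ) (hq : 0 < q) (hq1 : q < 1) (t s : Fin n) (hs : s < t) :
    ∑ π, wt n q π * (if opn n (t.val + 1) s π then
        4 * q ^ 2 / (1 - q) ^ 2 + 2 * (kap n (t.val + 1) π : ℝ) else 0) ≤
      ∑ π, wt n q π * (if opn n t.val s π then
        4 * q ^ 2 / (1 - q) ^ 2 + 2 * (kap n t.val π : ℝ) - 1 else 0) := by
  apply fib_le (agree2 n t) (agree2_equiv n t)
  intro π0
  by_cases ho : opn n t.val s π0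
  swap
  · apply le_of_eq
    apply Finset.sum_congr rfl
    intro π hπ
    have h1 := not_open_atom t s π0 π hs ho (mem_filter.mp hπ).2
    have h2 : ¬ opn n (t.val + 1) s π := fun h => h1 (opn_mono (Nat.le_succ _) h)
    rw [if_neg h1, if_neg h2]
  obtain ⟨h, g, hh, hh', hg, hg', hst⟩ := structure_lemma t s π0 hs ho
  obtain ⟨a, b, ha, hb, hab⟩ := aw_close n q t π0 h g hh hh' hg hg'
  set K : ℝ := 4 * q ^ 2 / (1 - q) ^ 2 with hK
  have hU := up_bound n q hq hq1 t π0
  have hD := down_bound n q hq hq1 t π0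
  have hdr := drift n q t π0 (fun k => K + 2 * (k : ℝ))
  have hM := aw_nonneg n q hq t π0 (fun _ => True)
  have hC := aw_nonneg n q hq t π0 (fun π => π h = t ∧ π t = g)
  have hL : ∑ π with agree2 n t π π0, wt n q π * (if opn n (t.val + 1) s π then
        K + 2 * (kap n (t.val + 1) π : ℝ) else 0) ≤
      ∑ π with agree2 n t π π0, wt n q π * (K + 2 * (kap n (t.val + 1) π : ℝ)) -
       K * aw n q t π0 (fun π => π h = t ∧ π t = g) := by
    rw [aw_ind, Finset.mul_sum, ← Finset.sum_sub_distrib]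
    apply Finset.sum_le_sum
    intro π hπ
    have h1 := (hst π (mem_filter.mp hπ).2).2
    have hw := (wt_pos hq π).le
    by_cases h2 : opn n (t.val + 1) s π
    · have h3 : ¬ (π h = t ∧ π t = g) := fun h3 => (h1.mpr h3) h2
      rw [if_pos h2, if_neg h3]
      simp
    · rw [if_neg h2, if_pos (h1.mp h2)]
      have : 0 ≤ wt n q π * (kap n (t.val + 1) π : ℝ) := by positivity
      linarith
  have hR : ∑ π with agree2 n t π π0, wt n q π * (if opn n t.val s π then
        K + 2 * (kap n t.val π : ℝ) - 1 else 0) =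
      aw n q t π0 (fun _ => True) * (K + 2 * (kap n t.val π0 : ℝ) - 1) := by
    rw [aw_ind, Finset.sum_mul]
    apply Finset.sum_congr rfl
    intro π hπ
    rw [agree2_kap (mem_filter.mp hπ).2, if_pos (hst π (mem_filter.mp hπ).2).1]
    simp
  rw [hR]
  refine hL.trans ?_
  rw [hdr]
  have hGm := gs_mul q (n - t.val)
  have hG := gs_ge_one hq (m := n - t.val) (by have := t.isLt; omega)
  have hp : 0 < q ^ (n - t.val) := pow_pos hq _
  set M := aw n q t π0 (fun _ => True)
  set U := aw n q t π0 (fun π => ¬ π⁻¹ t < t ∧ t < π t)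
  set D := aw n q t π0 (fun π => π⁻¹ t < t ∧ π t < t)
  set W := aw n q t π0 (fun π => π h = t ∧ π t = g)
  set G := gs q (n - t.val)
  set k := kap n t.val π0
  have h1q : 0 < 1 - q := by linarith
  have c1 : (1 - q) ^ 2 * (q ^ (a + b) * M) ≤ W := by
    rw [← hab]
    calc _ = (G * (1 - q)) ^ 2 * W := by ring
      _ ≤ 1 * W := by
        apply mul_le_mul_of_nonneg_right _ hC
        apply pow_le_one₀
        · exact mul_nonneg (by linarith) (by linarith)
        · linarith
      _ = W := one_mul _
  have c2 : q ^ (2 * k) ≤ q ^ (a + b + 2) :=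
    pow_le_pow_of_le_one hq.le hq1.le (by omega)
  have c3 : 4 * (q ^ k) ^ 2 * M ≤ K * W := by
    calc 4 * (q ^ k) ^ 2 * M = 4 * (q ^ (2 * k) * M) := by ring
      _ ≤ 4 * (q ^ (a + b + 2) * M) := by gcongr
      _ = K * ((1 - q) ^ 2 * (q ^ (a + b) * M)) := by
        rw [hK]; field_simp; ring
      _ ≤ K * W := by gcongr
  have c4 : U ≤ (q ^ k) ^ 2 * M := by
    refine hU.trans ?_
    apply mul_le_mul_of_nonneg_right _ hM
    rw [← pow_mul]
    exact pow_le_pow_of_le_one hq.le hq1.le (by omega)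
  obtain ⟨k', hk'⟩ : ∃ k', k = k' + 1 := ⟨k - 1, by omega⟩
  have hkk : ((k - 1 : ℕ) : ℝ) = (k : ℝ) - 1 := by rw [hk']; push_cast; simp
  simp only [hkk]
  push_cast
  have c5 : 0 ≤ (2 * q ^ k - 1) ^ 2 * M := mul_nonneg (sq_nonneg _) hM
  nlinarith

def PP (n : ℕ) (q : ℝ) (s : Fin n) (t : ℕ) : ℝ :=
  ∑ π, wt n q π * (if opn n t s π then 1 else 0)

lemma PP_nonneg (n : ℕ) (q : ℝ) (hq : 0 < q) (s : Fin n) (t : ℕ) : 0 ≤ PP n q s t := by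
  apply Finset.sum_nonneg
  intro π _
  have := wt_pos hq π
  split_ifs <;> simp [this.le]

lemma PP_le (n : ℕ) (q : ℝ) (hq : 0 < q) (s : Fin n) (t : ℕ) : PP n q s t ≤ ∑ π, wt n q π := by
  apply Finset.sum_le_sum
  intro π _
  have := wt_pos hq π
  split_ifs <;> simp [this.le]

lemma D3 (n : ℕ) (q : ℝ) (hq : 0 < q) (hq1 : q < 1) (t s : Fin n) (hs : s < t) :
    (1 - 1 / gs q (n - t.val) ^ 2) * PP n q s t.val ≤ PP n q s (t.val + 1) := by
  unfold PP
  rw [Finset.mul_sum]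
  apply fib_le (agree2 n t) (agree2_equiv n t)
  intro π0
  by_cases ho : opn n t.val s π0
  swap
  · apply le_of_eq
    apply Finset.sum_congr rfl
    intro π hπ
    have h1 := not_open_atom t s π0 π hs ho (mem_filter.mp hπ).2
    have h2 : ¬ opn n (t.val + 1) s π := fun h => h1 (opn_mono (Nat.le_succ _) h)
    rw [if_neg h1, if_neg h2]
    simp
  obtain ⟨h, g, hh, hh', hg, hg', hst⟩ := structure_lemma t s π0 hs ho
  obtain ⟨a, b, ha, hb, hab⟩ := aw_close n q t π0 h g hh hh' hg hg'
  have hG := gs_ge_one hq (m := n - t.val) (by have := t.isLt; omega)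
  have hM := aw_nonneg n q hq t π0 (fun _ => True)
  have e1 : ∑ π with agree2 n t π π0, (1 - 1 / gs q (n - t.val) ^ 2) *
      (wt n q π * (if opn n t.val s π then 1 else 0)) =
      (1 - 1 / gs q (n - t.val) ^ 2) * aw n q t π0 (fun _ => True) := by
    rw [aw_ind, Finset.mul_sum]
    apply Finset.sum_congr rfl
    intro π hπ
    rw [if_pos (hst π (mem_filter.mp hπ).2).1]
    simp
  have e2 : ∑ π with agree2 n t π π0, wt n q π * (if opn n (t.val + 1) s π then 1 else 0) =
      aw n q t π0 (fun _ => True) - aw n q t π0 (fun π => π h = t ∧ π t = g) := by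
    rw [aw_ind, aw_ind, ← Finset.sum_sub_distrib]
    apply Finset.sum_congr rfl
    intro π hπ
    have h1 := (hst π (mem_filter.mp hπ).2).2
    by_cases h2 : opn n (t.val + 1) s π
    · have h3 : ¬ (π h = t ∧ π t = g) := fun h3 => (h1.mpr h3) h2
      rw [if_pos h2, if_neg h3]
      simp
    · rw [if_neg h2, if_pos (h1.mp h2)]
      simp
  rw [e1, e2]
  have hle : q ^ (a + b) ≤ 1 := pow_le_one₀ hq.le hq1.le
  set M := aw n q t π0 (fun _ => True)
  set W := aw n q t π0 (fun π => π h = t ∧ π t = g)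
  set G := gs q (n - t.val)
  have hG2 : 0 < G ^ 2 := by positivity
  have : W ≤ M / G ^ 2 := by
    rw [le_div_iff₀ hG2, hab]
    nlinarith
  have e3 : (1 - 1 / G ^ 2) * M = M - M / G ^ 2 := by ring
  linarith

lemma D4 (n : ℕ) (q : ℝ) (hq : 0 < q) (hq1 : q < 1) (s : Fin n) :
    (1 - 1 / gs q (n - s.val)) * ∑ π, wt n q π ≤ PP n q s (s.val + 1) := by
  unfold PP
  rw [Finset.mul_sum]
  apply fib_le (agree1 n s) (agree1_equiv n s)
  intro π0
  have hG := gs_ge_one hq (m := n - s.val) (by have := s.isLt; omega)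
  have hG0 : 0 < gs q (n - s.val) := by linarith
  have hd : 0 ≤ 1 / gs q (n - s.val) := by positivity
  by_cases hex : ∃ π1, agree1 n s π1 π0 ∧ ¬ opn n (s.val + 1) s π1
  · obtain ⟨π1, h1, h2⟩ := hex
    have hg : s ≤ π0⁻¹ (π1 s) := by
      rw [← agree1_inv h1]; simp
    obtain ⟨a, ha⟩ := one_sided_eq n q s π0 (π1 s) hg
    rw [← Finset.mul_sum]
    have hle : q ^ a ≤ 1 := pow_le_one₀ hq.le hq1.le
    have hM : 0 ≤ ∑ π with agree1 n s π π0, wt n q π :=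
      Finset.sum_nonneg fun π _ => (wt_pos hq π).le
    have e : ∑ π with agree1 n s π π0, wt n q π - ∑ π with agree1 n s π π0 ∧ π s = π1 s, wt n q π ≤
        ∑ π with agree1 n s π π0, wt n q π * (if opn n (s.val + 1) s π then 1 else 0) := by
      rw [← Finset.filter_filter, Finset.sum_filter (fun π : Equiv.Perm (Fin n) => π s = π1 s), ← Finset.sum_sub_distrib]
      apply Finset.sum_le_sum
      intro π hπ
      have hw := (wt_pos hq π).le
      by_cases h3 : opn n (s.val + 1) s π
      · rw [if_pos h3]
        split_ifs <;> simp [hw]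
      · have := close_unique s π π1 ((agree1_equiv n s).trans (mem_filter.mp hπ).2
          ((agree1_equiv n s).symm h1)) h3 h2
        rw [if_neg h3, if_pos this]
        simp
    refine le_trans ?_ e
    set M := ∑ π with agree1 n s π π0, wt n q π
    set W := ∑ π with agree1 n s π π0 ∧ π s = π1 s, wt n q π
    set G := gs q (n - s.val)
    have : W ≤ M / G := by
      rw [le_div_iff₀ hG0, ha]
      nlinarith
    have e3 : (1 - 1 / G) * M = M - M / G := by ring
    linarith
  · push Not at hex
    apply Finset.sum_le_sum
    intro π hπ
    rw [if_pos (hex π (mem_filter.mp hπ).2)]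
    have hw := (wt_pos hq π).le
    nlinarith

lemma upper (n : ℕ) (q : ℝ) (hq : 0 < q) (hq1 : q < 1) (s : Fin n) :
    ∑ t ∈ Finset.Ico (s.val + 1) n, PP n q s t ≤ 6 * (q / (1 - q) ^ 2) * ∑ π, wt n q π := by
  set K : ℝ := 4 * q ^ 2 / (1 - q) ^ 2 with hK
  have hK0 : 0 ≤ K := by positivity
  set V : ℕ → ℝ := fun t => ∑ π, wt n q π * (if opn n t s π then K + 2 * (kap n t π : ℝ) else 0)
    with hV
  have hVn : ∀ t, 0 ≤ V t := by
    intro t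
    apply Finset.sum_nonneg
    intro π _
    have := wt_pos hq π
    split_ifs
    · positivity
    · simp
  have key : ∀ m, s.val + 1 + m ≤ n →
      ∑ t ∈ Finset.Ico (s.val + 1) (s.val + 1 + m), PP n q s t + V (s.val + 1 + m) ≤
        V (s.val + 1) := by
    intro m
    induction m with
    | zero => simp
    | succ m ih =>
      intro hm
      have h1 := ih (by omega)
      have h2 := D2 n q hq hq1 ⟨s.val + 1 + m, by omega⟩ s (by rw [Fin.lt_def]; simp; omega)
      have e : ∑ π, wt n q π * (if opn n (s.val + 1 + m) s π then
          K + 2 * (kap n (s.val + 1 + m) π : ℝ) - 1 else 0) =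
          V (s.val + 1 + m) - PP n q s (s.val + 1 + m) := by
        rw [hV, PP, ← Finset.sum_sub_distrib]
        apply Finset.sum_congr rfl
        intro π _
        split_ifs <;> ring
      have e' : V (s.val + 1 + (m + 1)) ≤ V (s.val + 1 + m) - PP n q s (s.val + 1 + m) := by
        rw [← e]; exact h2
      rw [← add_assoc, Finset.sum_Ico_succ_top (by omega)]
      rw [← add_assoc] at e'
      linarith
  have hsn := s.isLt
  have h := key (n - (s.val + 1)) (by omega)
  rw [show s.val + 1 + (n - (s.val + 1)) = n by omega] at h
  have hkb := kap_bound n q hq hq1 (s.val + 1) (by omega)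
  have hVb : V (s.val + 1) ≤ ∑ π, wt n q π * (K + 2 * (kap n (s.val + 1) π : ℝ)) := by
    apply Finset.sum_le_sum
    intro π _
    have := wt_pos hq π
    split_ifs
    · exact le_rfl
    · rw [mul_zero]; positivity
  have e2 : ∑ π, wt n q π * (K + 2 * (kap n (s.val + 1) π : ℝ)) =
      K * ∑ π, wt n q π + 2 * ∑ π, wt n q π * (kap n (s.val + 1) π : ℝ) := by
    rw [Finset.mul_sum, Finset.mul_sum, ← Finset.sum_add_distrib]
    apply Finset.sum_congr rfl
    intro π _
    ring
  have hZ : 0 ≤ ∑ π, wt n q π := Finset.sum_nonneg fun π _ => (wt_pos hq π).le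
  have h1q : 0 < 1 - q := by linarith
  have hc : K + 2 * (q / (1 - q)) ≤ 6 * (q / (1 - q) ^ 2) := by
    have e3 : K + 2 * (q / (1 - q)) = (4 * q ^ 2 + 2 * q * (1 - q)) / (1 - q) ^ 2 := by
      rw [hK]; field_simp
    rw [e3, ← mul_div_assoc]
    apply div_le_div_of_nonneg_right _ (by positivity)
    nlinarith
  have := mul_le_mul_of_nonneg_right hc hZ
  have := hVn n
  linarith

lemma real_ineq {q : ℝ} (hq : 0 < q) (hq1 : q < 1) (m : ℕ) (hm : 1 ≤ m) :
    1 / 5 * min (m : ℝ) (1 / (1 - q) ^ 2) ≤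
      1 + 1 / 5 * min ((m - 1 : ℕ) : ℝ) (1 / (1 - q) ^ 2) * (1 - 1 / gs q m ^ 2) := by
  have h1 := gs_mul q m
  have h2 := gs_ge_mul hq hq1 m
  have h3 := gs_ge_one hq hm
  have hm0 : (1 : ℝ) ≤ m := by exact_mod_cast hm
  have hm1 : ((m - 1 : ℕ) : ℝ) = m - 1 := by push_cast [hm]; ring
  rw [hm1]
  set G := gs q m
  set ε := 1 - q with hε
  have he : 0 < ε := by rw [hε]; linarith
  have h4 : 1 ≤ G * (ε + 1 / m) := by
    have : q ^ m ≤ G / m := by rw [le_div_iff₀ (by linarith)]; linarith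
    have e : G * (ε + 1 / m) = G * ε + G / m := by ring
    linarith
  have h5 : 1 / G ^ 2 ≤ 2 * ε ^ 2 + 2 * (1 / m) ^ 2 := by
    have : 1 / G ≤ ε + 1 / m := by
      rw [div_le_iff₀ (by linarith)]; linarith
    calc 1 / G ^ 2 = (1 / G) ^ 2 := by ring
      _ ≤ (ε + 1 / m) ^ 2 := by gcongr
      _ ≤ _ := by nlinarith [sq_nonneg (ε - 1 / (m : ℝ))]
  set r := 1 / ε ^ 2 with hr
  have hr0 : 0 < r := by positivity
  have hre : r * ε ^ 2 = 1 := by rw [hr]; field_simp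
  set x := min ((m : ℝ) - 1) r with hx
  have hx0 : 0 ≤ x := le_min (by linarith) hr0.le
  have hx1 : x ≤ r := min_le_right _ _
  have hx2 : x ≤ m := (min_le_left _ _).trans (by linarith)
  have h6 : min (m : ℝ) r ≤ x + 1 := by
    rw [hx, ← min_add_add_right]
    apply min_le_min <;> linarith
  have h7 : x * (1 / G ^ 2) ≤ 4 := by
    have a1 : x * (1 / G ^ 2) ≤ x * (2 * ε ^ 2 + 2 * (1 / m) ^ 2) := by gcongr
    have a2 : x * ε ^ 2 ≤ 1 := by rw [← hre]; gcongr
    have a3 : x * (1 / m) ^ 2 ≤ 1 := by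
      rw [one_div, inv_pow, ← div_eq_mul_inv, div_le_one (by positivity)]
      nlinarith
    linarith
  linarith

lemma lower_ind (n : ℕ) (q : ℝ) (hq : 0 < q) (hq1 : q < 1) (s : Fin n) (m : ℕ)
    (hm : m + s.val + 1 ≤ n) :
    1 / 5 * min (m : ℝ) (1 / (1 - q) ^ 2) * PP n q s (n - m) ≤
      ∑ t ∈ Finset.Ico (n - m) n, PP n q s t := by
  induction m with
  | zero =>
    have : 0 ≤ 1 / (1 - q) ^ 2 := by positivity
    rw [Nat.cast_zero, min_eq_left this]
    simp
  | succ m ih =>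
    have h1 := ih (by omega)
    have h2 := D3 n q hq hq1 ⟨n - (m + 1), by omega⟩ s (by rw [Fin.lt_def]; simp; omega)
    have h3 := real_ineq hq hq1 (m + 1) (by omega)
    have hP := PP_nonneg n q hq s (n - (m + 1))
    simp only at h2
    rw [show n - (m + 1) + 1 = n - m by omega, show n - (n - (m + 1)) = m + 1 by omega] at h2
    rw [Finset.sum_eq_sum_Ico_succ_bot (by omega), show n - (m + 1) + 1 = n - m by omega]
    rw [Nat.add_sub_cancel] at h3
    have h4 := mul_le_mul_of_nonneg_right h3 hP
    have h0 : 0 ≤ 1 / 5 * min (m : ℝ) (1 / (1 - q) ^ 2) :=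
      mul_nonneg (by norm_num) (le_min (by positivity) (by positivity))
    have h5 := mul_le_mul_of_nonneg_left h2 h0
    linarith

lemma lower (n : ℕ) (q : ℝ) (hq : 0 < q) (hq1 : q < 1) (s : Fin n) :
    1 / 40 * min (q / (1 - q) ^ 2) ((n : ℝ) - (s.val + 1)) * ∑ π, wt n q π ≤
      ∑ t ∈ Finset.Ico (s.val + 1) n, PP n q s t := by
  have hZ : 0 ≤ ∑ π, wt n q π := Finset.sum_nonneg fun π _ => (wt_pos hq π).le
  have hsn := s.isLt
  obtain ⟨m, hm⟩ : ∃ m, n = s.val + 1 + m := ⟨n - (s.val + 1), by omega⟩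
  have hmr : (n : ℝ) - (s.val + 1) = m := by
    have : (n : ℝ) = ((s.val + 1 + m : ℕ) : ℝ) := congrArg _ hm
    rw [this]; push_cast; ring
  rw [hmr]
  have h1 := lower_ind n q hq hq1 s m (by omega)
  rw [show n - m = s.val + 1 by omega] at h1
  refine le_trans ?_ h1
  rcases Nat.eq_zero_or_pos m with h0 | h0
  · subst h0
    have : 0 ≤ 1 / (1 - q) ^ 2 := by positivity
    have : 0 ≤ q / (1 - q) ^ 2 := by positivity
    rw [Nat.cast_zero, min_eq_right (by assumption), min_eq_left (by assumption)]
    simp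
  have h2 := D4 n q hq hq1 s
  have h3 := gs_ge_two hq (m := n - s.val) (by omega)
  have h4 : q / 2 ≤ 1 - 1 / gs q (n - s.val) := by
    have : 1 / gs q (n - s.val) ≤ 1 / (1 + q) := one_div_le_one_div_of_le (by linarith) h3
    have : q / 2 ≤ 1 - 1 / (1 + q) := by
      have e : 1 - 1 / (1 + q) = q / (1 + q) := by field_simp; ring
      rw [e]
      exact div_le_div_of_nonneg_left hq.le (by linarith) (by linarith)
    linarith
  have h5 := (mul_le_mul_of_nonneg_right h4 hZ).trans h2
  have hm1 : (1 : ℝ) ≤ m := by exact_mod_cast h0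
  have h1q : 0 < 1 - q := by linarith
  set r := 1 / (1 - q) ^ 2 with hr
  have hr1 : 1 ≤ r := by
    rw [hr, le_div_iff₀ (by positivity)]
    nlinarith
  have hqr : q / (1 - q) ^ 2 = q * r := by rw [hr]; ring
  rw [hqr]
  have h6 : 1 / 40 * min (q * r) m ≤ 1 / 5 * min (m : ℝ) r * (q / 2) := by
    rcases le_total (1 / 2) q with hh | hh
    · have : min (q * r) (m : ℝ) ≤ min (m : ℝ) r := by
        rw [min_comm]
        apply min_le_min le_rfl
        nlinarith
      have h7 : 0 ≤ min (m : ℝ) r := le_min (by linarith) (by linarith)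
      nlinarith
    · have h7 : 1 ≤ min (m : ℝ) r := le_min hm1 hr1
      have h8 : r ≤ 4 := by
        rw [hr, div_le_iff₀ (by positivity)]
        nlinarith
      have : min (q * r) (m : ℝ) ≤ 4 * q := (min_le_left _ _).trans (by nlinarith)
      nlinarith
  have h7 : 0 ≤ 1 / 5 * min (m : ℝ) r := 
    mul_nonneg (by norm_num) (le_min (by linarith) (by linarith))
  calc _ ≤ 1 / 5 * min (m : ℝ) r * (q / 2) * ∑ π, wt n q π := mul_le_mul_of_nonneg_right h6 hZ
    _ = 1 / 5 * min (m : ℝ) r * (q / 2 * ∑ π, wt n q π) := by ring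
    _ ≤ _ := mul_le_mul_of_nonneg_left h5 h7

lemma opn_iff (n t : ℕ) (s : Fin n) (π : Equiv.Perm (Fin n)) : opn n t s π ↔ t < cycMax n π s := by
  unfold opn cycMax cycleSet
  rw [Finset.lt_sup_iff]
  simp

lemma cycMax_formula (n : ℕ) (s : Fin n) (π : Equiv.Perm (Fin n)) :
    (cycMax n π s : ℝ) - (s.val + 1) =
      ∑ t ∈ Finset.Ico (s.val + 1) n, (if opn n t s π then (1 : ℝ) else 0) := by
  have h1 : s.val + 1 ≤ cycMax n π s :=
    Finset.le_sup (f := fun t : Fin n => (t : ℕ) + 1) (self_mem_cycleSet n π s)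
  have h2 : cycMax n π s ≤ n := Finset.sup_le fun x _ => x.isLt
  rw [Finset.sum_boole]
  have : (Finset.Ico (s.val + 1) n).filter (fun t => opn n t s π) =
      Finset.Ico (s.val + 1) (cycMax n π s) := by
    ext t
    rw [mem_filter, opn_iff, Finset.mem_Ico, Finset.mem_Ico]
    omega
  rw [this, Nat.card_Ico, Nat.cast_sub h1]
  push_cast
  ring

lemma Z_pos (n : ℕ) (q : ℝ) (hq : 0 < q) : 0 < mallowsZ n q :=
  Finset.sum_pos (fun _ _ => pow_pos hq _) Finset.univ_nonempty

lemma mExp_eq (n : ℕ) (q : ℝ) (X : Equiv.Perm (Fin n) → ℝ) :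
    mExp n q X = (∑ π, wt n q π * X π) / mallowsZ n q := by
  unfold mExp mallowsP wt
  rw [Finset.sum_div]
  apply Finset.sum_congr rfl
  intro π _
  ring

lemma part_two (n : ℕ) (q : ℝ) (hq : 0 < q) (hq1 : q < 1) (s : Fin n) :
    1 / 40 * min (q / (1 - q) ^ 2) ((n : ℝ) - (((s : ℕ) : ℝ) + 1))
        ≤ mExp n q (fun π => (cycMax n π s : ℝ) - (((s : ℕ) : ℝ) + 1)) ∧
      mExp n q (fun π => (cycMax n π s : ℝ) - (((s : ℕ) : ℝ) + 1))
        ≤ 6 * min (q / (1 - q) ^ 2) ((n : ℝ) - (((s : ℕ) : ℝ) + 1)) := by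
  have hZ := Z_pos n q hq
  have hZe : mallowsZ n q = ∑ π, wt n q π := rfl
  have e : ∑ π, wt n q π * ((cycMax n π s : ℝ) - (((s : ℕ) : ℝ) + 1)) =
      ∑ t ∈ Finset.Ico (s.val + 1) n, PP n q s t := by
    unfold PP
    rw [Finset.sum_comm]
    apply Finset.sum_congr rfl
    intro π _
    rw [cycMax_formula, Finset.mul_sum]
  have hl := lower n q hq hq1 s
  have hu := upper n q hq hq1 s
  have hu2 : ∑ t ∈ Finset.Ico (s.val + 1) n, PP n q s t ≤
      ((n : ℝ) - (((s : ℕ) : ℝ) + 1)) * ∑ π, wt n q π := by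
    have := Finset.sum_le_sum (s := Finset.Ico (s.val + 1) n) (fun t _ => PP_le n q hq s t)
    refine this.trans (le_of_eq ?_)
    rw [Finset.sum_const, Nat.card_Ico, nsmul_eq_mul, Nat.cast_sub s.isLt]
    push_cast
    ring
  rw [mExp_eq, e]
  rw [← hZe] at hl hu hu2
  refine ⟨(le_div_iff₀ hZ).mpr hl, (div_le_iff₀ hZ).mpr ?_⟩
  have hsn : (0 : ℝ) ≤ (n : ℝ) - (((s : ℕ) : ℝ) + 1) := by
    have : ((s.val + 1 : ℕ) : ℝ) ≤ n := by exact_mod_cast s.isLt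
    push_cast at this
    linarith
  rcases le_total (q / (1 - q) ^ 2) ((n : ℝ) - (((s : ℕ) : ℝ) + 1)) with h | h
  · rw [min_eq_left h]; exact hu
  · rw [min_eq_right h]; nlinarith [mul_nonneg hsn hZ.le]

def cj (n : ℕ) (π : Equiv.Perm (Fin n)) : Equiv.Perm (Fin n) :=
  Fin.revPerm * π * Fin.revPerm⁻¹

lemma cj_apply (n : ℕ) (π : Equiv.Perm (Fin n)) (i : Fin n) : cj n π i = (π i.rev).rev := by
  have : (Fin.revPerm : Equiv.Perm (Fin n))⁻¹ i = i.rev := by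
    rw [Equiv.Perm.inv_eq_iff_eq]; simp
  simp only [cj, Equiv.Perm.mul_apply, this, Fin.revPerm_apply]

lemma cj_cj (n : ℕ) (π : Equiv.Perm (Fin n)) : cj n (cj n π) = π := by
  ext i
  simp [cj_apply]

lemma wt_cj (n : ℕ) (q : ℝ) (π : Equiv.Perm (Fin n)) : wt n q (cj n π) = wt n q π := by
  unfold wt
  congr 1
  unfold invCount
  refine Finset.card_nbij' (fun x => (x.2.rev, x.1.rev)) (fun x => (x.2.rev, x.1.rev)) ?_ ?_ ?_ ?_
  · rintro ⟨a, b⟩ h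
    simpa [cj_apply] using h
  · rintro ⟨a, b⟩ h
    simpa [cj_apply] using h
  · rintro ⟨a, b⟩ h
    simp
  · rintro ⟨a, b⟩ h
    simp

lemma cj_same (n : ℕ) (π : Equiv.Perm (Fin n)) (x y : Fin n) :
    (cj n π).SameCycle x y ↔ π.SameCycle x.rev y.rev := by
  have h : ∀ i : Fin n, (Fin.revPerm : Equiv.Perm (Fin n))⁻¹ i = i.rev := by
    intro i
    rw [Equiv.Perm.inv_eq_iff_eq]; simp
  unfold cj
  rw [Equiv.Perm.sameCycle_conj, h, h]

lemma cycMin_eq (n : ℕ) (π : Equiv.Perm (Fin n)) (s : Fin n) :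
    cycMin n π s + cycMax n (cj n π) s.rev = n + 1 := by
  apply le_antisymm
  · obtain ⟨x, hx, hx'⟩ := Finset.exists_mem_eq_sup (cycleSet n (cj n π) s.rev)
      ⟨_, self_mem_cycleSet n (cj n π) s.rev⟩ (fun t : Fin n => (t : ℕ) + 1)
    have h1 : x.rev ∈ cycleSet n π s := by
      simpa [cycleSet, cj_same] using hx
    have h2 : cycMin n π s ≤ x.rev.val + 1 :=
      Finset.inf'_le (fun t : Fin n => (t : ℕ) + 1) h1
    have h3 : cycMax n (cj n π) s.rev = x.val + 1 := hx'
    rw [Fin.val_rev] at h2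
    have := x.isLt
    omega
  · obtain ⟨x, hx, hx'⟩ := Finset.exists_mem_eq_inf' ⟨s, self_mem_cycleSet n π s⟩
      (fun t : Fin n => (t : ℕ) + 1)
    have h1 : x.rev ∈ cycleSet n (cj n π) s.rev := by
      simpa [cycleSet, cj_same] using hx
    have h2 : x.rev.val + 1 ≤ cycMax n (cj n π) s.rev :=
      Finset.le_sup (f := fun t : Fin n => (t : ℕ) + 1) h1
    have h3 : cycMin n π s = x.val + 1 := hx'
    rw [Fin.val_rev] at h2
    have := x.isLt
    omega

lemma part_three (n : ℕ) (q : ℝ) (hq : 0 < q) (hq1 : q < 1) (s : Fin n) :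
    1 / 40 * min (q / (1 - q) ^ 2) ((s : ℕ) : ℝ)
        ≤ mExp n q (fun π => (((s : ℕ) : ℝ) + 1) - (cycMin n π s : ℝ)) ∧
      mExp n q (fun π => (((s : ℕ) : ℝ) + 1) - (cycMin n π s : ℝ))
        ≤ 6 * min (q / (1 - q) ^ 2) ((s : ℕ) : ℝ) := by
  have h := part_two n q hq hq1 s.rev
  have hr : ((s.rev : ℕ) : ℝ) + 1 = n - ((s : ℕ) : ℝ) := by
    have : s.rev.val + 1 + s.val = n := by rw [Fin.val_rev]; have := s.isLt; omega
    have : ((s.rev.val + 1 + s.val : ℕ) : ℝ) = n := by rw [this]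
    push_cast at this
    linarith
  have e : mExp n q (fun π => (cycMax n π s.rev : ℝ) - (((s.rev : ℕ) : ℝ) + 1)) =
      mExp n q (fun π => (((s : ℕ) : ℝ) + 1) - (cycMin n π s : ℝ)) := by
    rw [mExp_eq, mExp_eq]
    congr 1
    symm
    refine Finset.sum_nbij' (cj n) (cj n) (by simp) (by simp) (fun π _ => cj_cj n π)
      (fun π _ => cj_cj n π) ?_
    intro π _
    rw [wt_cj, hr]
    congr 1
    have : ((cycMin n π s + cycMax n (cj n π) s.rev : ℕ) : ℝ) = n + 1 := by
      rw [cycMin_eq]; push_cast; rfl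
    push_cast at this
    linarith
  rw [e, hr] at h
  simpa using h

theorem mallows_expected_cycle_diameter :
    ∃ c C : ℝ, 0 < c ∧ 0 < C ∧
      ∀ (n : ℕ) (q : ℝ), 1 ≤ n → 0 < q → q < 1 → ∀ s : Fin n,
        -- (i) expected diameter
        (c * min (q / (1 - q) ^ 2) ((n : ℝ) - 1)
            ≤ mExp n q (fun π => (cycMax n π s : ℝ) - (cycMin n π s : ℝ)) ∧
          mExp n q (fun π => (cycMax n π s : ℝ) - (cycMin n π s : ℝ))
            ≤ C * min (q / (1 - q) ^ 2) ((n : ℝ) - 1)) ∧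
        -- (ii) expected distance from `s` to the maximum of its cycle
        (c * min (q / (1 - q) ^ 2) ((n : ℝ) - (((s : ℕ) : ℝ) + 1))
            ≤ mExp n q (fun π => (cycMax n π s : ℝ) - (((s : ℕ) : ℝ) + 1)) ∧
          mExp n q (fun π => (cycMax n π s : ℝ) - (((s : ℕ) : ℝ) + 1))
            ≤ C * min (q / (1 - q) ^ 2) ((n : ℝ) - (((s : ℕ) : ℝ) + 1))) ∧
        -- (iii) expected distance from `s` to the minimum of its cycle
        (c * min (q / (1 - q) ^ 2) ((s : ℕ) : ℝ)
            ≤ mExp n q (fun π => (((s : ℕ) : ℝ) + 1) - (cycMin n π s : ℝ)) ∧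
          mExp n q (fun π => (((s : ℕ) : ℝ) + 1) - (cycMin n π s : ℝ))
            ≤ C * min (q / (1 - q) ^ 2) ((s : ℕ) : ℝ)) := by
  refine ⟨1 / 40, 12, by norm_num, by norm_num, ?_⟩
  intro n q hn hq hq1 s
  have h2 := part_two n q hq hq1 s
  have h3 := part_three n q hq hq1 s
  have h1q : 0 < 1 - q := by linarith
  have hK : 0 ≤ q / (1 - q) ^ 2 := by positivity
  have hs0 : (0 : ℝ) ≤ ((s : ℕ) : ℝ) := Nat.cast_nonneg _
  have hsn : (0 : ℝ) ≤ (n : ℝ) - (((s : ℕ) : ℝ) + 1) := by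
    have : ((s.val + 1 : ℕ) : ℝ) ≤ n := by exact_mod_cast s.isLt
    push_cast at this
    linarith
  have e : mExp n q (fun π => (cycMax n π s : ℝ) - (cycMin n π s : ℝ)) =
      mExp n q (fun π => (cycMax n π s : ℝ) - (((s : ℕ) : ℝ) + 1)) +
      mExp n q (fun π => (((s : ℕ) : ℝ) + 1) - (cycMin n π s : ℝ)) := by
    unfold mExp
    rw [← Finset.sum_add_distrib]
    apply Finset.sum_congr rfl
    intro π _
    ring
  have hn1 : (n : ℝ) - 1 = ((n : ℝ) - (((s : ℕ) : ℝ) + 1)) + ((s : ℕ) : ℝ) := by ring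
  rw [e, hn1]
  set x := (n : ℝ) - (((s : ℕ) : ℝ) + 1)
  set y := ((s : ℕ) : ℝ)
  set K := q / (1 - q) ^ 2
  have m1 : 0 ≤ min K x := le_min hK hsn
  have m2 : 0 ≤ min K y := le_min hK hs0
  have m3 : min K x ≤ min K (x + y) := min_le_min le_rfl (by linarith)
  have m4 : min K y ≤ min K (x + y) := min_le_min le_rfl (by linarith)
  have m5 : min K (x + y) ≤ min K x + min K y := by
    rcases le_total K x with hx | hx
    · rw [min_eq_left hx]
      have := min_le_left K (x + y)
      linarith
    · rcases le_total K y with hy | hy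
      · rw [min_eq_left hy]
        have := min_le_left K (x + y)
        linarith
      · rw [min_eq_right hx, min_eq_right hy]
        exact min_le_right _ _
  obtain ⟨a1, a2⟩ := h2
  obtain ⟨b1, b2⟩ := h3
  exact ⟨⟨by linarith, by linarith⟩, ⟨a1, by linarith⟩, ⟨b1, by linarith⟩⟩
end
end

section
/- There exist absolute constants c, C > 0 such that the following holds. For every integer n ≥ 1 and every real q with 0 < q < 1, if π is a random permutation with the Mallows distribution μ_{n,q} and N(π) denotes the number of cycles of π (i.e., the number of orbits of π acting on {1,…,n}, counting fixed points as cycles of length 1), then c · ((1−q)·n + log(n+1)) ≤ E[N(π)] ≤ C · ((1−q)·n + log(n+1)). -/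
open Finset
open scoped Classical BigOperators

noncomputable section

/-- The number of cycles (orbits, including fixed points) of a permutation. -/
def numCycles (n : ℕ) (π : Equiv.Perm (Fin n)) : ℕ :=
  (Finset.univ.image (fun s : Fin n => cycleSet n π s)).card


/-- number of cycles as number of classes -/
lemma numCycles_eq_card (n : ℕ) (π : Equiv.Perm (Fin n)) :
    numCycles n π = Nat.card (Quotient (Equiv.Perm.SameCycle.setoid π)) := by
  have h : ∀ s t : Fin n, cycleSet n π s = cycleSet n π t ↔ π.SameCycle s t := by
    intro s t
    constructor
    · intro h
      have : t ∈ cycleSet n π s := h ▸ self_mem_cycleSet n π t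
      simpa [cycleSet] using this
    · intro h
      ext u
      simp only [cycleSet, Finset.mem_filter, Finset.mem_univ, true_and]
      exact ⟨fun h' => h.symm.trans h', fun h' => h.trans h'⟩
  unfold numCycles
  let g : Quotient (Equiv.Perm.SameCycle.setoid π) → Finset (Fin n) :=
    Quotient.lift (cycleSet n π) (fun s t hst => (h s t).2 hst)
  have hg : Function.Injective g := by
    intro x y
    induction x using Quotient.inductionOn
    induction y using Quotient.inductionOn
    intro hxy
    exact Quotient.sound (s := Equiv.Perm.SameCycle.setoid π) ((h _ _).1 hxy)
  rw [Nat.card_eq_fintype_card, ← Finset.card_univ, ← Finset.card_image_of_injective _ hg]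
  congr 1
  ext A
  simp only [Finset.mem_image, Finset.mem_univ, true_and]
  constructor
  · rintro ⟨s, rfl⟩
    exact ⟨Quotient.mk _ s, rfl⟩
  · rintro ⟨x, rfl⟩
    induction x using Quotient.inductionOn with
    | h s => exact ⟨s, rfl⟩

lemma sameCycle_induct {α : Type*} (f : Equiv.Perm α) (R : α → α → Prop)
    (hr : ∀ x, R x x) (hs : ∀ x y, R x y → R y x) (ht : ∀ x y z, R x y → R y z → R x z)
    (hf : ∀ x, R x (f x)) {x y : α} (h : f.SameCycle x y) : R x y := by
  obtain ⟨k, rfl⟩ := h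
  induction k using Int.induction_on with
  | zero => simpa using hr x
  | succ i ih =>
    refine ht _ _ _ ih ?_
    rw [add_comm, zpow_add, zpow_one, Equiv.Perm.mul_apply]
    exact hf _
  | pred i ih =>
    refine ht _ _ _ ih (hs _ _ ?_)
    have := hf ((f ^ (-(i:ℤ) - 1)) x)
    rw [← Equiv.Perm.mul_apply, ← zpow_one_add] at this
    simpa using this

lemma numCycles_decompose (n : ℕ) (a : Fin (n+1)) (e : Equiv.Perm (Fin n)) :
    numCycles (n+1) (Equiv.Perm.decomposeFin.symm (a, e)) =
      numCycles n e + if a = 0 then 1 else 0 := by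
  set f := Equiv.Perm.decomposeFin.symm (a, e) with hf
  have f0 : f 0 = a := by simp [hf]
  have fs : ∀ i : Fin n, f i.succ = Equiv.swap 0 a (e i).succ := by intro i; simp [hf]
  rw [numCycles_eq_card, numCycles_eq_card]
  by_cases ha : a = 0
  · subst ha
    have up : ∀ i j : Fin n, e.SameCycle i j → f.SameCycle i.succ j.succ := by
      intro i j h
      refine sameCycle_induct e (fun i j => f.SameCycle i.succ j.succ) (fun _ => .refl _ _)
        (fun _ _ h => h.symm) (fun _ _ _ h h' => h.trans h') ?_ h
      intro i
      refine ⟨1, ?_⟩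
      simp [fs]
    let g : Fin (n+1) → Option (Quotient (Equiv.Perm.SameCycle.setoid e)) :=
      Fin.cases none (fun i => some (Quotient.mk _ i))
    have down : ∀ x y, f.SameCycle x y → g x = g y := by
      intro x y h
      refine sameCycle_induct f (fun x y => g x = g y) (fun _ => rfl)
        (fun _ _ h => h.symm) (fun _ _ _ h h' => h.trans h') ?_ h
      intro x
      refine Fin.cases ?_ (fun i => ?_) x
      · rw [f0]
      · rw [fs]
        simp only [g, Equiv.swap_self, Equiv.refl_apply, Fin.cases_succ]
        congr 1
        exact Quotient.sound (s := Equiv.Perm.SameCycle.setoid e) ⟨1, by simp⟩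
    let E : Quotient (Equiv.Perm.SameCycle.setoid f) ≃ Option (Quotient (Equiv.Perm.SameCycle.setoid e)) :=
      { toFun := Quotient.lift g down
        invFun := fun o => o.elim (Quotient.mk _ 0) (Quotient.lift (fun i => Quotient.mk _ i.succ)
          (fun i j h => Quotient.sound (up i j h)))
        left_inv := by
          intro x
          induction x using Quotient.inductionOn with
          | h x =>
            refine Fin.cases ?_ (fun i => ?_) x <;> simp [g]
        right_inv := by
          intro x
          rcases x with _ | x
          · simp [g]
          · induction x using Quotient.inductionOn with
            | h x => simp [g] }
    rw [Nat.card_congr E, if_pos rfl]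
    simp [Nat.card_eq_fintype_card]
  · have up : ∀ i j : Fin n, e.SameCycle i j → f.SameCycle i.succ j.succ := by
      intro i j h
      refine sameCycle_induct e (fun i j => f.SameCycle i.succ j.succ) (fun _ => .refl _ _)
        (fun _ _ h => h.symm) (fun _ _ _ h h' => h.trans h') ?_ h
      intro i
      by_cases h : (e i).succ = a
      · refine ⟨2, ?_⟩
        have h1 : f i.succ = 0 := by rw [fs, h]; simp
        rw [zpow_two, Equiv.Perm.mul_apply, h1, f0, h]
      · refine ⟨1, ?_⟩
        rw [zpow_one, fs, Equiv.swap_apply_of_ne_of_ne (Fin.succ_ne_zero _) h]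
    obtain ⟨b, rfl⟩ := Fin.exists_succ_eq.mpr ha
    let g : Fin (n+1) → (Quotient (Equiv.Perm.SameCycle.setoid e)) :=
      Fin.cases (Quotient.mk _ b) (fun i => (Quotient.mk _ i))
    have g0 : g 0 = Quotient.mk _ b := rfl
    have gs : ∀ i : Fin n, g i.succ = Quotient.mk _ i := fun _ => rfl
    have down : ∀ x y, f.SameCycle x y → g x = g y := by
      intro x y h
      refine sameCycle_induct f (fun x y => g x = g y) (fun _ => rfl)
        (fun _ _ h => h.symm) (fun _ _ _ h h' => h.trans h') ?_ h
      intro x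
      refine Fin.cases ?_ (fun i => ?_) x
      · rw [f0, g0, gs]
      · have h1 : (Quotient.mk (Equiv.Perm.SameCycle.setoid e) i) = Quotient.mk _ (e i) :=
          Quotient.sound (s := Equiv.Perm.SameCycle.setoid e) ⟨1, by simp⟩
        by_cases h : e i = b
        · rw [fs, h, Equiv.swap_apply_right, g0, gs, h1, h]
        · rw [fs, Equiv.swap_apply_of_ne_of_ne (Fin.succ_ne_zero _) (by simpa using h), gs, gs, h1]
    let E : Quotient (Equiv.Perm.SameCycle.setoid f) ≃ (Quotient (Equiv.Perm.SameCycle.setoid e)) :=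
      { toFun := Quotient.lift g down
        invFun := (Quotient.lift (fun i => Quotient.mk _ i.succ)
          (fun i j h => Quotient.sound (up i j h)))
        left_inv := by
          intro x
          induction x using Quotient.inductionOn with
          | h x =>
            refine Fin.cases ?_ (fun i => ?_) x
            · simp only [Quotient.lift_mk, g0]
              exact Quotient.sound (s := Equiv.Perm.SameCycle.setoid f)
                (Equiv.Perm.SameCycle.symm ⟨1, by simp [f0]⟩)
            · simp [gs]
        right_inv := by
          intro x
          induction x using Quotient.inductionOn with
          | h x => simp [gs] }
    rw [Nat.card_congr E, if_neg ha, add_zero]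

/-- insertion: `0 ↦ p`, the rest following `σ`. -/
def insPerm {n : ℕ} (p : Fin (n+1)) (σ : Equiv.Perm (Fin n)) : Equiv.Perm (Fin (n+1)) :=
  p.cycleRange.symm * Equiv.Perm.decomposeFin.symm (0, σ)

lemma insPerm_zero {n : ℕ} (p : Fin (n+1)) (σ : Equiv.Perm (Fin n)) : insPerm p σ 0 = p := by
  simp [insPerm]

lemma insPerm_succ {n : ℕ} (p : Fin (n+1)) (σ : Equiv.Perm (Fin n)) (i : Fin n) :
    insPerm p σ i.succ = p.succAbove (σ i) := by
  simp [insPerm]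

lemma insPerm_bij (n : ℕ) : Function.Bijective
    (fun x : Fin (n+1) × Equiv.Perm (Fin n) => insPerm x.1 x.2) := by
  rw [Fintype.bijective_iff_injective_and_card]
  constructor
  · rintro ⟨p, σ⟩ ⟨p', σ'⟩ h
    simp only at h
    have h0 : p = p' := by rw [← insPerm_zero p σ, h, insPerm_zero]
    subst h0
    congr 1
    ext i
    have := congrArg (fun f => f i.succ) h
    simp only [insPerm_succ] at this
    rw [Fin.succAbove_right_injective this]
  · simp [Fintype.card_perm, Nat.factorial_succ]

lemma invCount_eq_sum (n : ℕ) (π : Equiv.Perm (Fin n)) :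
    invCount n π = ∑ i, ∑ j, if i < j ∧ π j < π i then 1 else 0 := by
  unfold invCount
  rw [Finset.card_filter, ← Finset.univ_product_univ, Finset.sum_product]

lemma invCount_insPerm {n : ℕ} (p : Fin (n+1)) (σ : Equiv.Perm (Fin n)) :
    invCount (n+1) (insPerm p σ) = p + invCount n σ := by
  rw [invCount_eq_sum, invCount_eq_sum, Fin.sum_univ_succ]
  congr 1
  · rw [Fin.sum_univ_succ]
    simp only [insPerm_zero, insPerm_succ, lt_self_iff_false, false_and, if_false, zero_add,
      Fin.succ_pos, true_and]
    rw [Equiv.sum_comp σ (fun j => if p.succAbove j < p then 1 else 0), ← Finset.card_filter]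
    simp only [Fin.succAbove_lt_iff_castSucc_lt]
    simp only [Fin.lt_def, Fin.val_castSucc]
    have := Fin.card_filter_val_lt (n := n) (m := (p:ℕ))
    have hp := p.is_lt
    rw [min_eq_right (by omega)] at this
    convert this
  · refine Finset.sum_congr rfl fun i _ => ?_
    rw [Fin.sum_univ_succ]
    simp [insPerm_succ]

/-- contraction -/
def contr {n : ℕ} (τ : Equiv.Perm (Fin (n+1))) (p : Fin (n+1)) : Equiv.Perm (Fin n) :=
  (Equiv.Perm.decomposeFin (τ * p.cycleRange.symm)).2

lemma contr_spec {n : ℕ} (τ : Equiv.Perm (Fin (n+1))) (p : Fin (n+1)) :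
    Equiv.Perm.decomposeFin.symm (τ p, contr τ p) = τ * p.cycleRange.symm := by
  rw [Equiv.symm_apply_eq]
  refine Prod.ext ?_ rfl
  have h := Equiv.Perm.decomposeFin_symm_apply_zero
    (Equiv.Perm.decomposeFin (τ * p.cycleRange.symm)).1 (Equiv.Perm.decomposeFin (τ * p.cycleRange.symm)).2
  rw [Prod.mk.eta, Equiv.symm_apply_apply] at h
  rw [← h]; simp

lemma contr_succ {n : ℕ} (τ : Equiv.Perm (Fin (n+1))) (p : Fin (n+1)) (i : Fin n) :
    (contr τ p i).succ = Equiv.swap 0 (τ p) (τ (p.succAbove i)) := by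
  have h := congrArg (fun f => f i.succ) (contr_spec τ p)
  simp at h
  rw [← h]; simp

lemma numCycles_ins {n : ℕ} (τ : Equiv.Perm (Fin (n+1))) (p : Fin (n+1)) (σ : Equiv.Perm (Fin n)) :
    numCycles (n+1) (τ * insPerm p σ) =
      numCycles n (contr τ p * σ) + if τ p = 0 then 1 else 0 := by
  rw [← numCycles_decompose]
  congr 1
  unfold insPerm
  rw [← mul_assoc, ← contr_spec]
  ext x
  refine Fin.cases ?_ (fun i => ?_) x <;> simp

lemma sum_insPerm (n : ℕ) (F : Equiv.Perm (Fin (n+1)) → ℝ) :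
    ∑ π, F π = ∑ p : Fin (n+1), ∑ σ : Equiv.Perm (Fin n), F (insPerm p σ) := by
  rw [← Finset.sum_product', Finset.univ_product_univ]
  exact ((insPerm_bij n).sum_comp F).symm

/-- the q-integer -/
def qbr (q : ℝ) (m : ℕ) : ℝ := ∑ i ∈ Finset.range m, q ^ i

lemma qbr_pos {q : ℝ} (hq : 0 < q) (m : ℕ) : 0 < qbr q (m+1) :=
  Finset.sum_pos (fun i _ => pow_pos hq i) (by simp)

lemma sum_fin_qbr (q : ℝ) (m : ℕ) : ∑ p : Fin m, q ^ (p:ℕ) = qbr q m :=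
  Fin.sum_univ_eq_sum_range (fun i => q ^ i) m

lemma mallowsZ_succ (n : ℕ) (q : ℝ) : mallowsZ (n+1) q = qbr q (n+1) * mallowsZ n q := by
  unfold mallowsZ
  rw [sum_insPerm, ← sum_fin_qbr, Finset.sum_mul]
  refine Finset.sum_congr rfl fun p _ => ?_
  rw [Finset.mul_sum]
  refine Finset.sum_congr rfl fun σ _ => ?_
  rw [invCount_insPerm, pow_add]

lemma mallowsZ_pos {q : ℝ} (hq : 0 < q) (n : ℕ) : 0 < mallowsZ n q :=
  Finset.sum_pos (fun _ _ => pow_pos hq _) Finset.univ_nonempty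

/-- expected number of cycles of `τ * π` -/
def mL (n : ℕ) (q : ℝ) (τ : Equiv.Perm (Fin n)) : ℝ :=
  mExp n q (fun π => (numCycles n (τ * π) : ℝ))

lemma mL_eq (n : ℕ) (q : ℝ) (τ : Equiv.Perm (Fin n)) :
    mL n q τ = (∑ π, q ^ invCount n π * (numCycles n (τ * π) : ℝ)) / mallowsZ n q := by
  unfold mL mExp mallowsP
  rw [Finset.sum_div]
  exact Finset.sum_congr rfl fun _ _ => by ring

lemma mL_succ (n : ℕ) {q : ℝ} (hq : 0 < q) (τ : Equiv.Perm (Fin (n+1))) :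
    mL (n+1) q τ = (q ^ ((τ⁻¹ 0 : Fin (n+1)) : ℕ) + ∑ p : Fin (n+1), q ^ (p:ℕ) * mL n q (contr τ p))
      / qbr q (n+1) := by
  have hZ := mallowsZ_pos hq n
  have hb := qbr_pos hq n
  rw [mL_eq, mallowsZ_succ, div_eq_div_iff (by positivity) (by positivity)]
  have key : ∑ π, q ^ invCount (n+1) π * (numCycles (n+1) (τ * π) : ℝ)
      = (q ^ ((τ⁻¹ 0 : Fin (n+1)) : ℕ) + ∑ p : Fin (n+1), q ^ (p:ℕ) * mL n q (contr τ p))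
        * mallowsZ n q := by
    rw [sum_insPerm, add_mul, Finset.sum_mul]
    have h1 : q ^ ((τ⁻¹ 0 : Fin (n+1)) : ℕ) * mallowsZ n q
        = ∑ p : Fin (n+1), if τ p = 0 then q ^ (p:ℕ) * mallowsZ n q else 0 := by
      rw [Finset.sum_eq_single (τ⁻¹ 0)]
      · simp
      · intro p _ hp
        rw [if_neg]
        intro h
        exact hp (by rw [← h]; simp)
      · simp
    rw [h1, ← Finset.sum_add_distrib]
    refine Finset.sum_congr rfl fun p _ => ?_
    rw [mL_eq, mul_assoc, div_mul_cancel₀ _ hZ.ne']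
    have h2 : (if τ p = 0 then q ^ (p:ℕ) * mallowsZ n q else 0)
        = ∑ σ : Equiv.Perm (Fin n), q ^ (p:ℕ) * (q ^ invCount n σ * if τ p = 0 then 1 else 0) := by
      unfold mallowsZ
      split_ifs <;> simp [Finset.mul_sum]
    rw [h2, Finset.mul_sum, ← Finset.sum_add_distrib]
    refine Finset.sum_congr rfl fun σ _ => ?_
    rw [invCount_insPerm, numCycles_ins, pow_add]
    push_cast
    ring
  rw [key]; ring

lemma mL_zero (q : ℝ) (τ : Equiv.Perm (Fin 0)) : mL 0 q τ = 0 := by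
  unfold mL mExp
  refine Finset.sum_eq_zero fun π _ => ?_
  simp [numCycles]

lemma mL_upper {q : ℝ} (hq : 0 < q) (hq1 : q < 1) (n : ℕ) : ∀ τ : Equiv.Perm (Fin n),
    mL n q τ ≤ ∑ m ∈ Finset.range n, 1 / qbr q (m+1) := by
  induction n with
  | zero => intro τ; simp [mL_zero]
  | succ n ih =>
    intro τ
    have hb := qbr_pos hq n
    rw [mL_succ n hq, Finset.sum_range_succ, div_le_iff₀ hb, add_mul, one_div_mul_cancel hb.ne',
      add_comm]
    gcongr
    · rw [mul_comm, ← sum_fin_qbr q (n+1), Finset.sum_mul]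
      gcongr with p
      exact ih _
    · exact pow_le_one₀ hq.le hq1.le

lemma mL_lower1 {q : ℝ} (hq : 0 < q) (hq1 : q < 1) (n : ℕ) : ∀ τ : Equiv.Perm (Fin n),
    ∑ m ∈ Finset.range n, q ^ m / qbr q (m+1) ≤ mL n q τ := by
  induction n with
  | zero => intro τ; simp [mL_zero]
  | succ n ih =>
    intro τ
    have hb := qbr_pos hq n
    rw [mL_succ n hq, Finset.sum_range_succ, le_div_iff₀ hb, add_mul, div_mul_cancel₀ _ hb.ne',
      add_comm]
    gcongr ?_ + ?_
    · exact pow_le_pow_of_le_one hq.le hq1.le (Nat.lt_succ_iff.mp (Fin.is_lt _))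
    · rw [mul_comm, ← sum_fin_qbr q (n+1), Finset.sum_mul]
      gcongr with p
      exact ih _

/-- the invariant of the exposure process -/
def Good {n : ℕ} (τ : Equiv.Perm (Fin n)) (F : ℕ) : Prop :=
  ∃ k : ℕ, k ≤ n ∧ (∀ i j : Fin n, k ≤ (i:ℕ) → i < j → τ i < τ j) ∧
    (∑ i : Fin n, if (i:ℕ) < k then ((τ i : Fin n) : ℕ) else 0) ≤ F

lemma tail_le {n k : ℕ} (τ : Equiv.Perm (Fin (n+1)))
    (h : ∀ i j : Fin (n+1), k ≤ (i:ℕ) → i < j → τ i < τ j) (p : Fin (n+1)) (hp : k ≤ (p:ℕ)) :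
    τ p ≤ p := by
  have := Finset.card_le_card_of_injOn (s := Finset.Ici p) (t := Finset.Ici (τ p)) τ
    (by
      intro x hx
      simp only [Finset.coe_Ici, Set.mem_Ici] at hx ⊢
      rcases hx.eq_or_lt with rfl | hx
      · exact le_rfl
      · exact (h _ _ hp hx).le) τ.injective.injOn
  simp only [Fin.card_Ici] at this
  rw [Fin.le_def]
  omega

lemma good_step {n : ℕ} (τ : Equiv.Perm (Fin (n+1))) (F : ℕ) (hG : Good τ F) (p : Fin (n+1)) :
    ∃ F', Good (contr τ p) F' ∧ ((τ⁻¹ 0 : Fin (n+1)) : ℕ) + F' ≤ p + F := by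
  set r := τ⁻¹ 0 with hr
  have τr : τ r = 0 := by simp [hr]
  obtain ⟨k, hk, hmono, hsum, hrk⟩ : ∃ k : ℕ, k ≤ n + 1 ∧
      (∀ i j : Fin (n+1), k ≤ (i:ℕ) → i < j → τ i < τ j) ∧
      (∑ i : Fin (n+1), if (i:ℕ) < k then ((τ i : Fin (n+1)) : ℕ) else 0) ≤ F ∧ (r:ℕ) < k := by
    obtain ⟨k, hk, hmono, hsum⟩ := hG
    by_cases h : (r:ℕ) < k
    · exact ⟨k, hk, hmono, hsum, h⟩
    · have hrk : (r:ℕ) = k := by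
        by_contra hne
        have hlt : k < (r:ℕ) := by omega
        have := hmono ⟨k, by omega⟩ r le_rfl (by rw [Fin.lt_def]; exact hlt)
        rw [τr] at this
        exact absurd this (Fin.not_lt_zero _)
      refine ⟨k+1, by omega, fun i j hi hij => hmono i j (by omega) hij, ?_, by omega⟩
      refine le_trans (Finset.sum_le_sum fun i _ => ?_) hsum
      by_cases hi : i = r
      · subst hi; simp [τr]
      · have : (i:ℕ) ≠ r := fun h => hi (Fin.ext h)
        split_ifs <;> omega
  set Φ := (∑ i : Fin (n+1), if (i:ℕ) < k then ((τ i : Fin (n+1)) : ℕ) else 0) with hΦ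
  have hsw : ∀ x, x ≠ p → Equiv.swap 0 (τ p) (τ x) = if x = r then τ p else τ x := by
    intro x hx
    split_ifs with h
    · subst h; rw [τr]; simp
    · refine Equiv.swap_apply_of_ne_of_ne ?_ (fun h' => hx (τ.injective h'))
      rw [← τr]; exact fun h' => h (τ.injective h')
  let k' := if (p:ℕ) < k then k - 1 else k
  have hk' : ∀ i : Fin n, (i:ℕ) < k' ↔ ((p.succAbove i : Fin (n+1)) : ℕ) < k := by
    intro i
    simp only [k', Fin.succAbove, Fin.lt_def, Fin.val_castSucc]
    split_ifs <;> simp <;> omega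
  have hk'n : k' ≤ n := by
    simp only [k']
    have := p.is_lt
    split_ifs <;> omega
  have hcs : ∀ i, ((contr τ p i : Fin n) : ℕ) + 1 =
      if p.succAbove i = r then ((τ p : Fin (n+1)) : ℕ) else ((τ (p.succAbove i) : Fin (n+1)) : ℕ) := by
    intro i
    have := congrArg Fin.val (contr_succ τ p i)
    rw [hsw _ (Fin.succAbove_ne p i)] at this
    rw [Fin.val_succ] at this
    rw [this]
    split_ifs <;> rfl
  set Φ' := (∑ i : Fin n, if (i:ℕ) < k' then ((contr τ p i : Fin n) : ℕ) else 0) with hΦ'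
  have hcount : (∑ i : Fin n, if (i:ℕ) < k' then 1 else 0) = k' := by
    rw [← Finset.card_filter]
    have := Fin.card_filter_val_lt (n := n) (m := k')
    simp [this, hk'n]
  have e1 : Φ' + k' = ∑ i : Fin n, if ((p.succAbove i : Fin (n+1)) : ℕ) < k then
      (if p.succAbove i = r then ((τ p : Fin (n+1)) : ℕ) else ((τ (p.succAbove i) : Fin (n+1)) : ℕ)) else 0 := by
    conv_lhs => rw [← hcount]
    rw [hΦ', ← Finset.sum_add_distrib]
    refine Finset.sum_congr rfl fun i _ => ?_
    rw [← hcs]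
    simp only [← hk']
    split_ifs <;> rfl
  have e2 := Fin.sum_univ_succAbove (fun x : Fin (n+1) => if (x:ℕ) < k then
      (if x = r then ((τ p : Fin (n+1)) : ℕ) else ((τ x : Fin (n+1)) : ℕ)) else 0) p
  rw [← e1] at e2
  have e3 : (∑ x : Fin (n+1), if (x:ℕ) < k then
      (if x = r then ((τ p : Fin (n+1)) : ℕ) else ((τ x : Fin (n+1)) : ℕ)) else 0)
      = Φ + ((τ p : Fin (n+1)) : ℕ) := by
    have : ((τ p : Fin (n+1)) : ℕ) = ∑ x : Fin (n+1), if x = r then ((τ p : Fin (n+1)) : ℕ) else 0 := by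
      simp
    conv_rhs => rw [this, hΦ, ← Finset.sum_add_distrib]
    refine Finset.sum_congr rfl fun x _ => ?_
    by_cases hx : x = r
    · subst hx; simp [hrk, τr]
    · simp [hx]
  rw [e3] at e2
  refine ⟨Φ', ⟨k', hk'n, ?_, le_rfl⟩, ?_⟩
  · intro i j hi hij
    have hi' : ¬ ((p.succAbove i : Fin (n+1)) : ℕ) < k := fun h => by
      have := (hk' i).2 h; omega
    have hj' : ¬ ((p.succAbove j : Fin (n+1)) : ℕ) < k := fun h => by
      have := (hk' j).2 h; rw [Fin.lt_def] at hij; omega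
    have hi2 := hcs i
    have hj2 := hcs j
    rw [if_neg (by rintro h; rw [h] at hi'; exact hi' hrk)] at hi2
    rw [if_neg (by rintro h; rw [h] at hj'; exact hj' hrk)] at hj2
    have := hmono (p.succAbove i) (p.succAbove j) (by omega) (Fin.succAbove_lt_succAbove_iff.mpr hij)
    rw [Fin.lt_def] at this ⊢
    omega
  · by_cases hp : (p:ℕ) < k
    · have hkk : k' = k - 1 := by simp [k', hp]
      by_cases hpr : p = r
      · simp [hpr, hrk, τr] at e2
        have : (p:ℕ) = r := by rw [hpr]
        omega
      · simp [hp, hpr] at e2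
        omega
    · have hkk : k' = k := by simp [k', hp]
      have := tail_le τ hmono p (by omega)
      rw [Fin.le_def] at this
      simp [hp] at e2
      omega

lemma qbr_mul {q : ℝ} (m : ℕ) : qbr q m * (1 - q) = 1 - q ^ m := by
  unfold qbr
  induction m with
  | zero => simp
  | succ m ih => rw [Finset.sum_range_succ, add_mul, ih]; ring

lemma sum_mul_pow {q : ℝ} (hq : 0 < q) (hq1 : q < 1) (n : ℕ) :
    (1 - q) * ∑ p : Fin (n+1), (p:ℕ) * q ^ (p:ℕ) ≤ q * qbr q (n+1) := by
  have h : ∀ m : ℕ, (1 - q) * ∑ p ∈ Finset.range (m+1), (p:ℝ) * q ^ p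
      = q * qbr q m - m * q ^ (m+1) := by
    intro m
    induction m with
    | zero => simp [qbr]
    | succ m ih =>
      rw [Finset.sum_range_succ, mul_add, ih]
      simp only [qbr]
      rw [Finset.sum_range_succ]
      push_cast
      ring
  rw [Fin.sum_univ_eq_sum_range (fun i => (i:ℝ) * q ^ i) (n+1), h]
  have h2 : qbr q n ≤ qbr q (n+1) := by
    unfold qbr
    rw [Finset.sum_range_succ]
    have := pow_pos hq n
    linarith
  have h3 : 0 ≤ (n:ℝ) * q ^ (n+1) := by positivity
  nlinarith

lemma tangent {q : ℝ} (hq : 0 < q) (r : ℕ) :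
    (2 - r * ((1 - q) / q)) / 3 ≤ q ^ r := by
  have h1 : q ^ r = Real.exp (r * Real.log q) := by
    rw [mul_comm, Real.exp_mul, Real.exp_log hq, Real.rpow_natCast]
  have h2 : -((1 - q)/q) ≤ Real.log q := by
    have := Real.one_sub_inv_le_log_of_pos hq
    have e : -((1 - q)/q) = 1 - q⁻¹ := by field_simp; ring
    rw [e]; exact this
  have h3 : (r:ℝ) * -((1 - q)/q) ≤ r * Real.log q := by gcongr
  have h4 := Real.add_one_le_exp (r * Real.log q + 1)
  rw [Real.exp_add] at h4
  rw [h1]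
  have h5 := Real.exp_one_lt_d9
  have h6 := Real.exp_pos (r * Real.log q)
  nlinarith

lemma mL_lower2 {q : ℝ} (hq : 0 < q) (hq1 : q < 1) (n : ℕ) :
    ∀ (τ : Equiv.Perm (Fin n)) (F : ℕ), Good τ F →
    (1 - q) * (n - (1 - q) / q * F) / 3 ≤ mL n q τ := by
  have hq' : 0 < 1 - q := by linarith
  induction n with
  | zero =>
    intro τ F _
    rw [mL_zero]
    have : 0 ≤ (1 - q) / q * F := by positivity
    simp only [Nat.cast_zero, zero_sub]
    nlinarith
  | succ n ih =>
    intro τ F hG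
    have hb := qbr_pos hq n
    set b := qbr q (n+1) with hbdef
    rw [mL_succ n hq, le_div_iff₀ hb]
    set r : Fin (n+1) := τ⁻¹ 0 with hr
    set β := (1 - q) / q with hβ
    have hβ0 : 0 < β := by positivity
    have step : ∀ p : Fin (n+1), q ^ (p:ℕ) * ((1 - q) * (n - β * (p + F - r)) / 3)
        ≤ q ^ (p:ℕ) * mL n q (contr τ p) := by
      intro p
      obtain ⟨F', hG', hF'⟩ := good_step τ F hG p
      have h1 := ih _ F' hG'
      have h2 : (r:ℝ) + F' ≤ p + F := by exact_mod_cast hF'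
      gcongr
      refine le_trans ?_ h1
      gcongr
      linarith
    have hs := Finset.sum_le_sum (fun p (_ : p ∈ Finset.univ) => step p)
    have hexp : ∑ p : Fin (n+1), q ^ (p:ℕ) * ((1 - q) * (n - β * (p + F - r)) / 3)
        = (1 - q) * (n - β * (F - r)) / 3 * b
          - β / 3 * ((1 - q) * ∑ p : Fin (n+1), (p:ℕ) * q ^ (p:ℕ)) := by
      rw [hbdef, ← sum_fin_qbr, Finset.mul_sum, Finset.mul_sum, Finset.mul_sum,
        ← Finset.sum_sub_distrib]
      exact Finset.sum_congr rfl fun p _ => by ring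
    have hm := sum_mul_pow hq hq1 n
    have hm2 : β / 3 * ((1 - q) * ∑ p : Fin (n+1), (p:ℕ) * q ^ (p:ℕ)) ≤ (1 - q) / 3 * b := by
      calc _ ≤ β / 3 * (q * b) := by gcongr
        _ = _ := by rw [hβ]; field_simp
    have ht := tangent hq (r:ℕ)
    have hb1 : (1 - q) * b ≤ 1 := by
      have := qbr_mul (q := q) (n+1)
      have := pow_pos hq (n+1)
      rw [hbdef]; nlinarith
    have hqr := pow_pos hq (r:ℕ)
    have ht2 : (2 - r * β) / 3 * ((1 - q) * b) ≤ q ^ (r:ℕ) := by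
      have h0 : 0 < (1 - q) * b := by positivity
      nlinarith
    push_cast
    rw [hexp] at hs
    nlinarith

lemma inv_qbr_le {q : ℝ} (hq : 0 < q) (hq1 : q < 1) (m : ℕ) :
    1 / qbr q (m+1) ≤ (1 - q) + ((m:ℝ)+1)⁻¹ := by
  have hb := qbr_pos hq m
  have h1 := qbr_mul (q := q) (m+1)
  have h2 : ((m:ℝ)+1) * q ^ (m+1) ≤ qbr q (m+1) := by
    have : ∑ i ∈ Finset.range (m+1), q ^ (m+1) ≤ qbr q (m+1) := by
      refine Finset.sum_le_sum fun i hi => ?_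
      exact pow_le_pow_of_le_one hq.le hq1.le (Finset.mem_range.mp hi).le
    simpa using this
  have hm : (0:ℝ) < (m:ℝ)+1 := by positivity
  rw [div_le_iff₀ hb, add_mul, mul_comm (1 - q), h1]
  have h3 : q ^ (m+1) ≤ ((m:ℝ)+1)⁻¹ * qbr q (m+1) := by
    rw [← div_eq_inv_mul, le_div_iff₀ hm]; linarith
  linarith

lemma qbr_le {q : ℝ} (hq : 0 < q) (hq1 : q < 1) (m : ℕ) : qbr q (m+1) ≤ (m:ℝ)+1 := by
  have : qbr q (m+1) ≤ ∑ i ∈ Finset.range (m+1), (1:ℝ) :=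
    Finset.sum_le_sum fun i _ => pow_le_one₀ hq.le hq1.le
  simpa using this

lemma harm_eq (n : ℕ) : ((harmonic n : ℚ) : ℝ) = ∑ m ∈ Finset.range n, ((m:ℝ)+1)⁻¹ := by
  simp [harmonic]

lemma log_lower {q : ℝ} (hq : 0 < q) (hq1 : q < 1) (n : ℕ) (hn : 1 ≤ n) (E : ℝ)
    (hA : (1 - q) * n / 3 ≤ E) (hB : ∑ m ∈ Finset.range n, q ^ m / qbr q (m+1) ≤ E) :
    Real.log ((n:ℝ)+1) / 12 ≤ E := by
  set M := Nat.sqrt n with hM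
  have hMn : M * M ≤ n := Nat.sqrt_le n
  have hnM : n < (M+1) * (M+1) := Nat.lt_succ_sqrt n
  have hM1 : 1 ≤ M := Nat.sqrt_pos.mpr hn
  have hMn' : (M:ℝ) * M ≤ n := by exact_mod_cast hMn
  have hM1' : (1:ℝ) ≤ M := by exact_mod_cast hM1
  have hlog : Real.log ((n:ℝ)+1) ≤ 2 * Real.log ((M:ℝ)+1) := by
    have h : ((n:ℝ)+1) ≤ ((M:ℝ)+1)^2 := by
      have : n + 1 ≤ (M+1)^2 := by rw [pow_two]; omega
      exact_mod_cast this
    calc _ ≤ Real.log (((M:ℝ)+1)^2) := Real.log_le_log (by positivity) h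
      _ = _ := by rw [Real.log_pow]; norm_num
  have hl0 : 0 ≤ Real.log ((M:ℝ)+1) := Real.log_nonneg (by linarith)
  by_cases h : (M:ℝ) * (1 - q) ≤ 1/2
  · have hqM : 1/2 ≤ q ^ M := by
      have := one_add_mul_le_pow (a := q - 1) (by linarith) M
      have e : 1 + (q - 1) = q := by ring
      rw [e] at this
      nlinarith
    have hMle : M ≤ n := Nat.sqrt_le_self n
    have h1 : (1/2) * ∑ m ∈ Finset.range M, ((m:ℝ)+1)⁻¹ ≤ E := by
      refine le_trans ?_ hB
      rw [Finset.mul_sum]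
      refine le_trans (Finset.sum_le_sum fun m hm => ?_)
        (Finset.sum_le_sum_of_subset_of_nonneg (Finset.range_mono hMle)
          (fun m _ _ => (div_pos (pow_pos hq m) (qbr_pos hq m)).le))
      rw [← div_eq_mul_inv]
      have hb := qbr_pos hq m
      have h2 : 1/2 ≤ q ^ m :=
        hqM.trans (pow_le_pow_of_le_one hq.le hq1.le (Finset.mem_range.mp hm).le)
      exact div_le_div₀ (by positivity) h2 hb (qbr_le hq hq1 m)
    rw [← harm_eq] at h1
    have h2 := log_add_one_le_harmonic M
    push_cast at h2
    linarith
  · push Not at h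
    have h1 : (M:ℝ)/2 ≤ (1 - q) * n := by
      have : (1 - q) * (M * M) ≤ (1 - q) * n := by
        have : 0 < 1 - q := by linarith
        gcongr
      nlinarith
    have h2 := Real.log_le_sub_one_of_pos (show (0:ℝ) < (M:ℝ)+1 by positivity)
    linarith

theorem mallows_expected_number_of_cycles :
    ∃ c C : ℝ, 0 < c ∧ 0 < C ∧
      ∀ (n : ℕ) (q : ℝ), 1 ≤ n → 0 < q → q < 1 →
        c * ((1 - q) * (n : ℝ) + Real.log ((n : ℝ) + 1))
            ≤ mExp n q (fun π => (numCycles n π : ℝ)) ∧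
          mExp n q (fun π => (numCycles n π : ℝ))
            ≤ C * ((1 - q) * (n : ℝ) + Real.log ((n : ℝ) + 1)) := by
  refine ⟨1/24, 3, by norm_num, by norm_num, ?_⟩
  intro n q hn hq hq1
  have hE : mExp n q (fun π => (numCycles n π : ℝ)) = mL n q 1 := by
    simp [mL]
  rw [hE]
  have hn0 : (1:ℝ) ≤ n := by exact_mod_cast hn
  constructor
  · have hG : Good (1 : Equiv.Perm (Fin n)) 0 := ⟨0, by omega, by simp, by simp⟩
    have hA := mL_lower2 hq hq1 n 1 0 hG
    simp only [Nat.cast_zero, mul_zero, sub_zero] at hA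
    have hB := mL_lower1 hq hq1 n 1
    have hC := log_lower hq hq1 n hn _ hA hB
    have : 0 ≤ (1 - q) * n := by
      have : 0 ≤ 1 - q := by linarith
      positivity
    linarith
  · have h1 := mL_upper hq hq1 n 1
    have h2 : ∑ m ∈ Finset.range n, 1 / qbr q (m+1)
        ≤ ∑ m ∈ Finset.range n, ((1 - q) + ((m:ℝ)+1)⁻¹) :=
      Finset.sum_le_sum fun m _ => inv_qbr_le hq hq1 m
    rw [Finset.sum_add_distrib, ← harm_eq] at h2
    simp only [Finset.sum_const, Finset.card_range, nsmul_eq_mul] at h2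
    have h3 := harmonic_le_one_add_log n
    have h4 : Real.log n ≤ Real.log ((n:ℝ)+1) := Real.log_le_log (by linarith) (by linarith)
    have h5 : Real.log 2 ≤ Real.log ((n:ℝ)+1) := Real.log_le_log (by norm_num) (by linarith)
    have h6 := Real.log_two_gt_d9
    have : 0 ≤ (1 - q) * n := by
      have : 0 ≤ 1 - q := by linarith
      positivity
    nlinarith
end
end
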